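/- arXiv:1404.1851 — 2 statements merged into one kernel-verified Lean document; each statement's English description precedes it below -/
import Mathlib

section
/- For even n ≥ 6, if π is a permutation of {1,…,n} with rt(C_n, π) = n − 1, then π is the rotation a ↦ a + 1 (mod n) or its inverse a ↦ a − 1 (mod n). -/
/-- One round of routing on the cycle `C_n`.  The configuration `σ` sends each
pebble to its current vertex.  A set `M` of vertices encodes the matching
`{(i, i+1) : i ∈ M}`; the matching condition is that no two chosen edges share
a vertex.  The pebbles on the endpoints of each chosen edge are swapped. -/
def CycleStep (n : ℕ) (σ τ : Equiv.Perm (ZMod n)) : Prop :=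
  ∃ M : Finset (ZMod n), (∀ i ∈ M, i + 1 ∉ M) ∧
    ∀ p : ZMod n,
      τ p = if σ p ∈ M then σ p + 1 else if σ p - 1 ∈ M then σ p - 1 else σ p

/-- `RoutesIn n π k` : starting from the configuration where pebble `p` sits at
vertex `π p`, `k` rounds of swaps along matchings of `C_n` bring every pebble
to its destination (pebble `p` to vertex `p`). -/
def RoutesIn (n : ℕ) (π : Equiv.Perm (ZMod n)) (k : ℕ) : Prop :=
  ∃ f : ℕ → Equiv.Perm (ZMod n), f 0 = π ∧ f k = 1 ∧
    ∀ t < k, CycleStep n (f t) (f (t + 1))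

/-- The routing number `rt(C_n, π)`: the minimum number of rounds needed to
route the permutation `π` on the cycle `C_n`. -/
noncomputable def rt (n : ℕ) (π : Equiv.Perm (ZMod n)) : ℕ :=
  sInf {k | RoutesIn n π k}


/-- Invariant of the periodic odd-even transposition sort. -/
structure SInv (n : ℕ) (w : ℤ → ℤ) (H : ℤ → ℤ → ℤ) (e B : ℤ) : Prop where
  per : ∀ i, w (i + n) = w i + n
  hrec : ∀ i c, H (i + 1) c = H i c + if c < w i then 1 else 0
  bd : ∃ D : ℤ, (∀ i c, i ≤ c - D → H i c = 0) ∧ (∀ i c, c + D ≤ i → H i c = i - c - 1)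
  pot : ∀ i c, w i ≤ c → 1 ≤ H i c →
    2 * H i c + c - i + (if (i + e) % 2 = 0 then 0 else 1) ≤ B

theorem H_mono {w : ℤ → ℤ} {H : ℤ → ℤ → ℤ}
    (hrec : ∀ i c, H (i + 1) c = H i c + if c < w i then 1 else 0) (i c : ℤ) (k : ℕ) :
    H i c ≤ H (i + k) c ∧ H (i + k) c ≤ H i c + k := by
  induction k with
  | zero => simp
  | succ k ih =>
    have := hrec (i + k) c
    push_cast
    rw [← add_assoc]
    split_ifs at this <;> omega

theorem H_mono' {w : ℤ → ℤ} {H : ℤ → ℤ → ℤ}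
    (hrec : ∀ i c, H (i + 1) c = H i c + if c < w i then 1 else 0) (i j c : ℤ) (h : i ≤ j) :
    H i c ≤ H j c ∧ H j c ≤ H i c + (j - i) := by
  have := H_mono hrec i c (j - i).toNat
  have e : (((j - i).toNat : ℕ) : ℤ) = j - i := Int.toNat_of_nonneg (by omega)
  rw [e] at this
  simpa using this

theorem H_nonneg {n : ℕ} {w : ℤ → ℤ} {H : ℤ → ℤ → ℤ} {e B : ℤ} (I : SInv n w H e B) (i c : ℤ) :
    0 ≤ H i c ∧ i - c - 1 ≤ H i c := by
  obtain ⟨D, h1, h2⟩ := I.bd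
  constructor
  · have := H_mono' I.hrec (min i (c - D)) i c (by omega)
    rw [h1 (min i (c - D)) c (by omega)] at this
    omega
  · have := H_mono' I.hrec i (max i (c + D)) c (by omega)
    rw [h2 (max i (c + D)) c (by omega)] at this
    omega

theorem SInv_final {n : ℕ} {w : ℤ → ℤ} {H : ℤ → ℤ → ℤ} {e : ℤ} (I : SInv n w H e 0) (i : ℤ) :
    w i = i := by
  have key : ∀ i c, w i ≤ c → H i c = 0 := by
    intro i c h
    by_contra hne
    have h0 := H_nonneg I i c
    have hp := I.pot i c h (by omega)
    have h1 := H_nonneg I (i + 1) c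
    have hr := I.hrec i c
    rw [if_neg (by omega)] at hr
    split_ifs at hp <;> omega
  have h1 : i ≤ w i := by
    have a := key i (w i) le_rfl
    have h1 := H_nonneg I (i + 1) (w i)
    have hr := I.hrec i (w i)
    rw [if_neg (by omega)] at hr
    omega
  have h2 : w i ≤ i := by
    obtain ⟨D, hD1, hD2⟩ := I.bd
    have hr := I.hrec i (w i - 1)
    rw [if_pos (by omega)] at hr
    have h0 := H_nonneg I i (w i - 1)
    -- all later positions are ones
    have hk : ∀ k : ℕ, H (i + k) (w i - 1) = H i (w i - 1) + k := by
      intro k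
      induction k with
      | zero => simp
      | succ k ih =>
        rcases Nat.eq_zero_or_pos k with rfl | hkp
        · simpa using hr
        · have hr' := I.hrec (i + k) (w i - 1)
          have : ¬ w (i + k) ≤ w i - 1 := by
            intro hh
            have := key _ _ hh
            omega
          rw [if_pos (by omega)] at hr'
          push_cast
          rw [← add_assoc]
          omega
    have h3 := hk (max 0 (w i - 1 + D - i)).toNat
    have e : (((max 0 (w i - 1 + D - i)).toNat : ℕ) : ℤ) = max 0 (w i - 1 + D - i) :=
      Int.toNat_of_nonneg (by omega)
    rw [e] at h3
    rw [hD2 _ _ (by omega)] at h3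
    omega
  omega

/-- one odd-even step -/
def stepW (e : ℤ) (w : ℤ → ℤ) (i : ℤ) : ℤ :=
  if (i + e) % 2 = 0 then max (w (i - 1)) (w i) else min (w i) (w (i + 1))

def stepH (e : ℤ) (w : ℤ → ℤ) (H : ℤ → ℤ → ℤ) (i c : ℤ) : ℤ :=
  if (i + e) % 2 = 0 then H (i - 1) c + (if c < min (w (i - 1)) (w i) then 1 else 0) else H i c

theorem SInv_step {n : ℕ} (he : Even n) {w : ℤ → ℤ} {H : ℤ → ℤ → ℤ} {e B : ℤ}
    (I : SInv n w H e B) : SInv n (stepW e w) (stepH e w H) (e + 1) (B - 1) := by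
  obtain ⟨m, hm⟩ := he
  refine ⟨?_, ?_, ?_, ?_⟩
  · intro i
    have h1 := I.per i
    have h2 := I.per (i - 1)
    have h3 := I.per (i + 1)
    unfold stepW
    rw [show i + (n : ℤ) - 1 = i - 1 + n by ring, show i + (n : ℤ) + 1 = i + 1 + n by ring, h1, h2, h3]
    split_ifs <;> omega
  · intro i c
    unfold stepH stepW
    have h1 := I.hrec (i - 1) c
    have h2 := I.hrec i c
    rw [sub_add_cancel] at h1
    rw [add_sub_cancel_right]
    by_cases hp : (i + e) % 2 = 0
    · have hp' : ¬ (i + 1 + e) % 2 = 0 := by omega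
      simp only [hp, hp', if_true, if_false]
      split_ifs at * <;> omega
    · have hp' : (i + 1 + e) % 2 = 0 := by omega
      simp only [hp, hp', if_true, if_false]
  · obtain ⟨D, h1, h2⟩ := I.bd
    refine ⟨D + 2, ?_, ?_⟩
    · intro i c h
      unfold stepH
      have a1 := h1 i c (by omega)
      have a2 := h1 (i - 1) c (by omega)
      have h3 := I.hrec (i - 1) c
      rw [sub_add_cancel] at h3
      split_ifs at * <;> omega
    · intro i c h
      unfold stepH
      have a1 := h2 i c (by omega)
      have a2 := h2 (i - 1) c (by omega)
      have a3 := h2 (i + 1) c (by omega)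
      have h3 := I.hrec (i - 1) c
      have h4 := I.hrec i c
      rw [sub_add_cancel] at h3
      split_ifs at * <;> omega
  · intro i c
    unfold stepH stepW
    have p1 := I.pot i c
    have p2 := I.pot (i - 1) c
    have p3 := I.pot (i + 1) c
    have h1 := I.hrec (i - 1) c
    have h2 := I.hrec i c
    rw [sub_add_cancel] at h1
    by_cases hp : (i + e) % 2 = 0
    · have q1 : ¬ (i + (e + 1)) % 2 = 0 := by omega
      have q2 : ¬ (i - 1 + e) % 2 = 0 := by omega
      simp only [hp, q1, q2, if_true, if_false] at *
      intro a b
      rw [if_neg (by omega)] at b ⊢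
      rw [if_neg (by omega)] at h1
      have := p2 (by omega) (by omega)
      omega
    · have q1 : (i + (e + 1)) % 2 = 0 := by omega
      have q2 : (i + 1 + e) % 2 = 0 := by omega
      simp only [hp, q1, q2, if_true, if_false] at *
      intro a b
      by_cases hw : w i ≤ c
      · have := p1 hw b
        omega
      · rw [if_pos (by omega)] at h2
        have := p3 (by omega) (by omega)
        omega

theorem RoutesIn_succ {n k : ℕ} {σ τ : Equiv.Perm (ZMod n)} (h : CycleStep n σ τ)
    (hk : RoutesIn n τ k) : RoutesIn n σ (k + 1) := by
  obtain ⟨f, h0, h1, h2⟩ := hk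
  refine ⟨fun t => Nat.casesOn t σ f, rfl, h1, ?_⟩
  intro t ht
  cases t with
  | zero => simpa [h0] using h
  | succ t => exact h2 t (by omega)

theorem step_exists {n : ℕ} (he : Even n) (hn : 6 ≤ n) {w : ℤ → ℤ}
    (per : ∀ i, w (i + n) = w i + n) (e : ℤ)
    (σ : Equiv.Perm (ZMod n)) (hl : ∀ i : ℤ, σ (w i : ZMod n) = (i : ZMod n)) :
    ∃ τ : Equiv.Perm (ZMod n), CycleStep n σ τ ∧
      ∀ i : ℤ, τ (stepW e w i : ZMod n) = (i : ZMod n) := by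
  classical
  have : NeZero n := ⟨by omega⟩
  obtain ⟨m, hm⟩ := he
  let M : Finset (ZMod n) := Finset.univ.filter
    (fun v => ∃ i : ℤ, (i : ZMod n) = v ∧ ¬ (i + e) % 2 = 0 ∧ w (i + 1) < w i)
  have perk : ∀ i k : ℤ, w (i + n * k) = w i + n * k := by
    intro i k
    induction k using Int.induction_on with
    | zero => simp
    | succ k ih =>
      rw [show i + (n : ℤ) * (k + 1) = (i + n * k) + n by ring, per, ih]; ring
    | pred k ih =>
      have := per (i + n * (-k - 1))
      rw [show i + (n : ℤ) * (-k - 1) + n = i + n * (-k) by ring, ih] at this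
      linarith
  have hM : ∀ i : ℤ, (i : ZMod n) ∈ M ↔ (¬ (i + e) % 2 = 0 ∧ w (i + 1) < w i) := by
    intro i
    simp only [M, Finset.mem_filter, Finset.mem_univ, true_and]
    constructor
    · rintro ⟨j, hj, h1, h2⟩
      rw [ZMod.intCast_eq_intCast_iff_dvd_sub] at hj
      obtain ⟨k, hk⟩ := hj
      have hi : i = j + n * k := by linarith
      subst hi
      have a1 := perk j k
      have a2 := perk (j + 1) k
      rw [show j + 1 + (n : ℤ) * k = j + n * k + 1 by ring] at a2
      refine ⟨?_, by omega⟩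
      have : (n : ℤ) * k = 2 * (m * k) := by rw [hm]; push_cast; ring
      omega
    · intro h
      exact ⟨i, rfl, h⟩
  have lift : ∀ v : ZMod n, ∃ i : ℤ, (i : ZMod n) = v := fun v => ZMod.intCast_surjective v
  have hmat : ∀ i ∈ M, i + 1 ∉ M := by
    intro v hv hv'
    obtain ⟨i, rfl⟩ := lift v
    have h1 := (hM i).1 hv
    have h2 := (hM (i + 1)).1 (by push_cast; exact hv')
    omega
  let g : ZMod n → ZMod n := fun v => if v ∈ M then v + 1 else if v - 1 ∈ M then v - 1 else v
  have hg : Function.Involutive g := by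
    intro v
    simp only [g]
    by_cases h1 : v ∈ M
    · have := hmat v h1
      simp [h1, this]
    · by_cases h2 : v - 1 ∈ M
      · simp [h1, h2]
      · simp [h1, h2]
  refine ⟨σ.trans hg.toPerm, ⟨M, hmat, fun p => rfl⟩, ?_⟩
  intro i
  have key : ∀ j : ℤ, (σ.trans hg.toPerm) (w j : ZMod n) = g (j : ZMod n) := by
    intro j
    show g (σ (w j : ZMod n)) = _
    rw [hl]
  have m0 := hM i
  have m1 := hM (i - 1)
  have m2 := hM (i + 1)
  push_cast at m1 m2
  rw [sub_add_cancel] at m1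
  unfold stepW
  by_cases hp : (i + e) % 2 = 0
  · rw [if_pos hp]
    have c0 : (i : ZMod n) ∉ M := by rw [m0]; tauto
    by_cases hw : w i < w (i - 1)
    · have c1 : (i : ZMod n) - 1 ∈ M := by rw [m1]; exact ⟨by omega, hw⟩
      rw [max_eq_left hw.le, key]
      simp [g, c1]
    · have c1 : (i : ZMod n) - 1 ∉ M := by rw [m1]; tauto
      rw [max_eq_right (by omega), key]
      simp [g, c0, c1]
  · rw [if_neg hp]
    have c1 : (i : ZMod n) - 1 ∉ M := by rw [m1]; omega
    by_cases hw : w (i + 1) < w i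
    · have c0 : (i : ZMod n) ∈ M := by rw [m0]; exact ⟨hp, hw⟩
      have c2 : (i : ZMod n) + 1 ∉ M := by rw [m2]; omega
      rw [min_eq_right hw.le, key]
      simp [g, c0, c2]
    · have c0 : (i : ZMod n) ∉ M := by rw [m0]; tauto
      rw [min_eq_left (by omega), key]
      simp [g, c0, c1]

theorem routes_of_SInv {n : ℕ} (he : Even n) (hn : 6 ≤ n) (B : ℕ) :
    ∀ (w : ℤ → ℤ) (H : ℤ → ℤ → ℤ) (e : ℤ) (σ : Equiv.Perm (ZMod n)), SInv n w H e B →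
      (∀ i : ℤ, σ (w i : ZMod n) = (i : ZMod n)) → RoutesIn n σ B := by
  induction B with
  | zero =>
    intro w H e σ I hl
    refine ⟨fun _ => σ, rfl, ?_, by simp⟩
    ext v
    obtain ⟨i, rfl⟩ := ZMod.intCast_surjective v
    have := hl i
    have I' : SInv n w H e 0 := by simpa using I
    rw [SInv_final I' i] at this
    simp [this]
  | succ B ih =>
    intro w H e σ I hl
    obtain ⟨τ, h1, h2⟩ := step_exists he hn I.per e σ hl
    refine RoutesIn_succ h1 (ih _ (stepH e w H) (e + 1) τ ?_ h2)
    have := SInv_step he I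
    simpa using this

theorem succ_ediv_aux (n : ℕ) (hn : 0 < n) (x : ℤ) :
    (x + 1) / (n : ℤ) = x / n + if (n : ℤ) ∣ x + 1 then 1 else 0 := by
  have hn' : (0 : ℤ) < n := by exact_mod_cast hn
  have h1 := Int.mul_ediv_add_emod x n
  have h2 := Int.emod_nonneg x hn'.ne'
  have h3 := Int.emod_lt_of_pos x hn'
  split_ifs with h
  · obtain ⟨k, hk⟩ := h
    rw [hk, Int.mul_ediv_cancel_left _ hn'.ne']
    have : (n : ℤ) * (k - x / n) = x % n + 1 := by linarith
    have a : k - x / n ≤ 1 := by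
      by_contra hh
      nlinarith
    have b : 0 < k - x / n := by
      by_contra hh
      nlinarith
    omega
  · have h4 : x % n + 1 ≠ n := by
      intro hh
      exact h ⟨x / n + 1, by linarith⟩
    rw [add_zero]
    refine ((Int.ediv_emod_unique (r := x % n + 1) hn').2 ⟨?_, ?_, ?_⟩).1
    · linarith
    · omega
    · omega

theorem dvd_iff_cast (n : ℕ) [NeZero n] (x : ℤ) (r : ZMod n) :
    (n : ℤ) ∣ x - r.val ↔ r = (x : ZMod n) := by
  rw [← ZMod.intCast_eq_intCast_iff_dvd_sub]
  simp

theorem S_succ (n : ℕ) [NeZero n] (x : ℤ) :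
    ∑ r : ZMod n, (x + 1 - r.val) / (n : ℤ) = ∑ r : ZMod n, (x - r.val) / (n : ℤ) + 1 := by
  have : ∀ r : ZMod n, (x + 1 - r.val) / (n : ℤ) =
      (x - r.val) / (n : ℤ) + if r = ((x + 1 : ℤ) : ZMod n) then 1 else 0 := by
    intro r
    have := succ_ediv_aux n (NeZero.pos n) (x - r.val)
    rw [show x - (r.val : ℤ) + 1 = x + 1 - r.val by ring] at this
    rw [this]
    simp only [dvd_iff_cast]
  rw [Finset.sum_congr rfl (fun r _ => this r), Finset.sum_add_distrib]
  simp

theorem S_diff (n : ℕ) [NeZero n] (x : ℤ) :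
    ∑ r : ZMod n, (x - r.val) / (n : ℤ) = x + ∑ r : ZMod n, (0 - (r.val : ℤ)) / (n : ℤ) := by
  induction x using Int.induction_on with
  | zero => simp
  | succ k ih => rw [S_succ, ih]; ring
  | pred k ih =>
    have := S_succ n (-k - 1)
    rw [sub_add_cancel, ih] at this
    linarith

theorem exists_H (n : ℕ) [NeZero n] (σ : Equiv.Perm (ZMod n)) (D : ZMod n → ℤ) (m M : ℤ)
    (hres : ∀ r, (D r : ZMod n) = σ r - r) (hsum : ∑ r, D r = 0)
    (hm : ∀ r, m ≤ D r) (hM : ∀ r, D r ≤ M) :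
    ∃ H : ℤ → ℤ → ℤ,
      (∀ i c, H (i + 1) c = H i c + if c < i + D (i : ZMod n) then 1 else 0) ∧
      (∀ i c, i ≤ c + 1 - M → H i c = 0) ∧ (∀ i c, c + 1 - m ≤ i → H i c = i - c - 1) := by
  have hn' : (0 : ℤ) < n := by exact_mod_cast NeZero.pos n
  refine ⟨fun i c => ∑ r : ZMod n,
    max 0 ((i - 1 - r.val) / (n : ℤ) - (c - (r.val + D r)) / (n : ℤ)), ?_, ?_, ?_⟩
  · intro i c
    have key : ∀ r : ZMod n,
        max 0 ((i + 1 - 1 - r.val) / (n : ℤ) - (c - (r.val + D r)) / (n : ℤ)) =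
        max 0 ((i - 1 - r.val) / (n : ℤ) - (c - (r.val + D r)) / (n : ℤ)) +
        if r = (i : ZMod n) then (if c < i + D r then 1 else 0) else 0 := by
      intro r
      have h := succ_ediv_aux n (NeZero.pos n) (i - 1 - r.val)
      rw [show i - 1 - (r.val : ℤ) + 1 = i - r.val by ring] at h
      rw [show i + 1 - 1 - (r.val : ℤ) = i - r.val by ring]
      simp only [dvd_iff_cast] at h
      by_cases hr : r = (i : ZMod n)
      · rw [if_pos hr] at h ⊢
        have hd := (dvd_iff_cast n i r).2 hr
        obtain ⟨q, hq⟩ := hd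
        have e1 : (i - (r.val : ℤ)) / n = q := by
          rw [hq, Int.mul_ediv_cancel_left _ hn'.ne']
        have e2 : (c - (r.val + D r)) / (n : ℤ) < q ↔ c < i + D r := by
          rw [Int.ediv_lt_iff_lt_mul hn']
          have : q * n = n * q := mul_comm _ _
          constructor <;> intro h <;> linarith
        rw [e1] at h ⊢
        split_ifs <;> omega
      · rw [if_neg hr] at h ⊢
        rw [h, add_zero, add_zero]
    show ∑ r : ZMod n, _ = _
    rw [Finset.sum_congr rfl (fun r _ => key r), Finset.sum_add_distrib]
    simp
  · intro i c h
    apply Finset.sum_eq_zero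
    intro r _
    have := hM r
    have : (i - 1 - r.val) / (n : ℤ) ≤ (c - (r.val + D r)) / (n : ℤ) :=
      Int.ediv_le_ediv hn' (by linarith)
    omega
  · intro i c h
    have hE : ∀ r : ZMod n, ∃ e : ℤ, r.val + D r = (σ r).val + n * e := by
      intro r
      have : (n : ℤ) ∣ (r.val + D r) - (σ r).val := by
        rw [← ZMod.intCast_eq_intCast_iff_dvd_sub]
        push_cast
        simp [hres]
      obtain ⟨e, he⟩ := this
      exact ⟨e, by linarith⟩
    choose E hE using hE
    have hEs : ∑ r, E r = 0 := by
      have h1 : ∑ r : ZMod n, ((r.val : ℤ) + D r) = ∑ r : ZMod n, (((σ r).val : ℤ) + n * E r) :=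
        Finset.sum_congr rfl (fun r _ => hE r)
      rw [Finset.sum_add_distrib, Finset.sum_add_distrib, hsum,
        Equiv.sum_comp σ (fun r : ZMod n => (r.val : ℤ)), ← Finset.mul_sum] at h1
      have : (n : ℤ) * ∑ r, E r = 0 := by linarith
      rcases mul_eq_zero.1 this with h | h
      · omega
      · exact h
    have key : ∀ r : ZMod n,
        max 0 ((i - 1 - r.val) / (n : ℤ) - (c - (r.val + D r)) / (n : ℤ)) =
        (i - 1 - r.val) / (n : ℤ) - (c - (σ r).val) / (n : ℤ) + E r := by
      intro r
      have := hm r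
      have h1 : (c - (r.val + D r)) / (n : ℤ) ≤ (i - 1 - r.val) / (n : ℤ) :=
        Int.ediv_le_ediv hn' (by linarith)
      have h2 : (c - (r.val + D r)) / (n : ℤ) = (c - (σ r).val) / (n : ℤ) - E r := by
        rw [hE r, show c - (((σ r).val : ℤ) + n * E r) = (c - (σ r).val) + n * (- E r) by ring,
          Int.add_mul_ediv_left _ _ hn'.ne']
        ring
      omega
    show ∑ r : ZMod n, _ = _
    rw [Finset.sum_congr rfl (fun r _ => key r), Finset.sum_add_distrib, Finset.sum_sub_distrib,
      hEs, Equiv.sum_comp σ (fun r : ZMod n => (c - (r.val : ℤ)) / (n : ℤ)), S_diff, S_diff n c]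
    ring

theorem all_zero {w : ℤ → ℤ} {H : ℤ → ℤ → ℤ}
    (hrec : ∀ i c, H (i + 1) c = H i c + if c < w i then 1 else 0) {i j c : ℤ}
    (h : H j c = H i c) : ∀ k, i ≤ k → k < j → w k ≤ c := by
  intro k h1 h2
  have a := H_mono' hrec i k c h1
  have b := H_mono' hrec (k + 1) j c (by omega)
  have d := hrec k c
  split_ifs at d <;> omega

theorem all_one {w : ℤ → ℤ} {H : ℤ → ℤ → ℤ}
    (hrec : ∀ i c, H (i + 1) c = H i c + if c < w i then 1 else 0) {i j c : ℤ}
    (h : H j c = H i c + (j - i)) : ∀ k, i ≤ k → k < j → c < w k := by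
  intro k h1 h2
  have a := H_mono' hrec i k c h1
  have b := H_mono' hrec (k + 1) j c (by omega)
  have d := hrec k c
  split_ifs at d <;> omega

def FF (n M a : ℤ) (d : ℤ → ℤ) (x : ℤ) : Prop :=
  1 ≤ a ∧ 1 ≤ M ∧ (∀ j, 0 ≤ j → j < a → M - j ≤ d (x + j)) ∧
    (∀ j, a ≤ j → j < n → d (x + j) ≤ M - j - 1)

def LG (n M a : ℤ) (d : ℤ → ℤ) (x : ℤ) : Prop :=
  1 ≤ a ∧ 2 ≤ M ∧ (∀ j, a < j → j < n → d (x + j) ≤ M - j - 1) ∧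
    (d x ≤ M - 1 → ∀ j, 1 ≤ j → j ≤ a → M - j ≤ d (x + j))

def RG (n M a : ℤ) (d : ℤ → ℤ) (x : ℤ) : Prop :=
  2 ≤ a ∧ 1 ≤ M ∧ (∀ j, 0 ≤ j → j ≤ a - 2 → M - j ≤ d (x + j)) ∧
    (M - n + 1 ≤ d (x + (n - 1)) → ∀ j, a - 1 ≤ j → j ≤ n - 2 → d (x + j) ≤ M - j - 1)

theorem lemmaA (n : ℕ) [NeZero n] (hn : 6 ≤ n) (he : Even n) (π : Equiv.Perm (ZMod n))
    (D : ZMod n → ℤ) (M a : ℤ) (hMa : M + a = n)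
    (hres : ∀ r, (D r : ZMod n) = π.symm r - r) (hsum : ∑ r, D r = 0)
    (hm : ∀ r, -a ≤ D r) (hM : ∀ r, D r ≤ M)
    (hF : ∀ x : ℤ, ¬ FF n M a (fun i : ℤ => D (i : ZMod n)) x)
    (e : ℤ) (hp : ∀ x : ℤ, LG n M a (fun i : ℤ => D (i : ZMod n)) x ∨
      RG n M a (fun i : ℤ => D (i : ZMod n)) x → (x + e) % 2 = 0) :
    RoutesIn n π (n - 2) := by
  obtain ⟨H, hrec, hlo, hhi⟩ := exists_H n π.symm D (-a) M hres hsum hm hM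
  refine routes_of_SInv he hn (n - 2) (fun i => i + D (i : ZMod n)) H (e + a + 1) π ?_ ?_
  swap
  · intro i
    push_cast
    rw [hres]
    simp
  refine ⟨?_, hrec, ?_, ?_⟩
  · intro i
    simp only [Int.cast_add, Int.cast_natCast, CharP.cast_eq_zero, add_zero]
    ring
  · refine ⟨max M (a + 1), ?_, ?_⟩
    · intro i c h
      exact hlo i c (by omega)
    · intro i c h
      exact hhi i c (by omega)
  · intro i c hz h1
    have hB : ((n - 2 : ℕ) : ℤ) = n - 2 := by omega
    rw [hB]
    change i + D (i : ZMod n) ≤ c at hz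
    obtain ⟨x, hx⟩ : ∃ x, x = c + 1 - M := ⟨_, rfl⟩
    have H0 : H x c = 0 := hlo x c (by omega)
    have Hn : H (x + n) c = a := by rw [hhi _ _ (by omega)]; omega
    have hix : x < i := by
      by_contra hh
      rw [hlo i c (by omega)] at h1
      omega
    have hin : i < x + n := by
      have := hm (i : ZMod n)
      omega
    have k1 := H_mono' hrec x i c (by omega)
    have k2 := H_mono' hrec (i + 1) (x + n) c (by omega)
    have k3 := hrec i c
    rw [if_neg (by omega)] at k3
    have hfull : ¬ (H i c = a ∧ i = x + a) := by
      rintro ⟨e1, e2⟩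
      apply hF x
      refine ⟨by omega, by omega, ?_, ?_⟩
      · intro j j1 j2
        have := all_one hrec (i := x) (j := i) (c := c) (by omega) (x + j) (by omega) (by omega)
        simp only
        omega
      · intro j j1 j2
        have := all_zero hrec (i := i) (j := x + n) (c := c) (by omega) (x + j) (by omega) (by omega)
        simp only
        omega
    by_cases hL : H i c = a ∧ i = x + a + 1
    · obtain ⟨e1, e2⟩ := hL
      have := hp x (Or.inl ⟨by omega, by omega, ?_, ?_⟩)
      · split_ifs <;> omega
      · intro j j1 j2
        have := all_zero hrec (i := i) (j := x + n) (c := c) (by omega) (x + j) (by omega) (by omega)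
        simp only
        omega
      · intro hd j j1 j2
        have hr := hrec x c
        simp only at hd
        rw [if_neg (by omega)] at hr
        have := all_one hrec (i := x + 1) (j := i) (c := c) (by omega) (x + j) (by omega) (by omega)
        simp only
        omega
    by_cases hR : H i c = a - 1 ∧ i = x + a - 1
    · obtain ⟨e1, e2⟩ := hR
      have := hp x (Or.inr ⟨by omega, by omega, ?_, ?_⟩)
      · split_ifs <;> omega
      · intro j j1 j2
        have := all_one hrec (i := x) (j := i) (c := c) (by omega) (x + j) (by omega) (by omega)
        simp only
        omega
      · intro hd j j1 j2
        have hr := hrec (x + (n - 1)) c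
        simp only at hd
        rw [show x + ((n : ℤ) - 1) + 1 = x + n by ring, if_pos (by omega)] at hr
        have := all_zero hrec (i := i) (j := x + (n - 1)) (c := c) (by omega) (x + j) (by omega)
          (by omega)
        simp only
        omega
    split_ifs <;> omega

def Special (n M a : ℤ) (d : ℤ → ℤ) (x : ℤ) : Prop :=
  2 ≤ a ∧ 2 ≤ M ∧ (-a < d x ∧ d x < M) ∧ d (x + a) = M - a ∧
    (∀ j, 1 ≤ j → j < a → d (x + j) = M) ∧ (∀ j, a < j → j < n → d (x + j) = -a)

section conflict
variable (n M a : ℤ) (d : ℤ → ℤ)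

theorem conflLL (hper : ∀ i k, d (i + n * k) = d i) (hMa : M + a = n)
    (hmM : ∀ x, ¬ (d (x + (n - 1)) = -a ∧ d x = M)) (hm : ∀ r, -a ≤ d r) (hM : ∀ r, d r ≤ M)
    (x s : ℤ) (h1 : LG n M a d x) (h2 : LG n M a d (x + s)) (hs : 1 ≤ s) (hs' : s < n) :
    False := by
  obtain ⟨a1, m2, z1, o1⟩ := h1
  obtain ⟨-, -, z2, o2⟩ := h2
  have pe : ∀ i, d (i + n) = d i := fun i => by simpa using hper i 1
  have q1 := z1 (n - 1) (by omega) (by omega)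
  have q2 := z2 (n - 1) (by omega) (by omega)
  have o1 := o1 (by have := hmM x; have := hm (x + (n - 1)); have := hM x; omega)
  have o2 := o2 (by
    have := hmM (x + s); have := hm (x + s + (n - 1)); have := hM (x + s); omega)
  by_cases s1 : s = 1
  · have b1 := o2 a (by omega) (by omega)
    have b2 := z1 (a + 1) (by omega) (by omega)
    rw [show x + s + a = x + (a + 1) by rw [s1]; ring] at b1
    omega
  by_cases s2 : s = n - 1
  · have b1 := o1 a (by omega) (by omega)
    have b2 := z2 (a + 1) (by omega) (by omega)
    rw [show x + s + (a + 1) = x + a + n by rw [s2]; ring, pe] at b2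
    omega
  rw [show x + s + (n - 1) = x + (s - 1) + n by ring, pe] at q2
  by_cases s3 : s - 1 ≤ a
  · have := o1 (s - 1) (by omega) s3
    omega
  have b1 := z1 (s + 1) (by omega) (by omega)
  have b2 := o2 1 (by omega) (by omega)
  rw [show x + s + 1 = x + (s + 1) by ring] at b2
  omega

theorem conflRR (hper : ∀ i k, d (i + n * k) = d i) (hMa : M + a = n)
    (hmM : ∀ x, ¬ (d (x + (n - 1)) = -a ∧ d x = M)) (hm : ∀ r, -a ≤ d r) (hM : ∀ r, d r ≤ M)
    (x s : ℤ) (h1 : RG n M a d x) (h2 : RG n M a d (x + s)) (hs : 1 ≤ s) (hs' : s < n) :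
    False := by
  obtain ⟨a1, m2, o1, z1⟩ := h1
  obtain ⟨-, -, o2, z2⟩ := h2
  have pe : ∀ i, d (i + n) = d i := fun i => by simpa using hper i 1
  have q1 := o1 0 (by omega) (by omega)
  have q2 := o2 0 (by omega) (by omega)
  rw [add_zero] at q1 q2
  have z1 := z1 (by have := hmM x; have := hm (x + (n - 1)); have := hM x; omega)
  have z2 := z2 (by
    have := hmM (x + s); have := hm (x + s + (n - 1)); have := hM (x + s); omega)
  by_cases s1 : s = 1
  · have b1 := o2 (a - 2) (by omega) (by omega)
    have b2 := z1 (a - 1) (by omega) (by omega)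
    rw [show x + s + (a - 2) = x + (a - 1) by rw [s1]; ring] at b1
    omega
  by_cases s2 : s = n - 1
  · have b1 := o1 (a - 2) (by omega) (by omega)
    have b2 := z2 (a - 1) (by omega) (by omega)
    rw [show x + s + (a - 1) = x + (a - 2) + n by rw [s2]; ring, pe] at b2
    omega
  by_cases s3 : a - 1 ≤ s
  · have := z1 s (by omega) (by omega)
    omega
  have b1 := o1 (s - 2) (by omega) (by omega)
  have b2 := z2 (n - 2) (by omega) (by omega)
  rw [show x + s + (n - 2) = x + (s - 2) + n by ring, pe] at b2
  omega

theorem conflLR (hper : ∀ i k, d (i + n * k) = d i) (hMa : M + a = n)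
    (hmM : ∀ x, ¬ (d (x + (n - 1)) = -a ∧ d x = M)) (hm : ∀ r, -a ≤ d r) (hM : ∀ r, d r ≤ M)
    (hinj : ∀ i j, i + d i = j + d j → i = j)
    (x s : ℤ) (h1 : LG n M a d x) (h2 : RG n M a d (x + s)) (hs : 1 ≤ s) (hs' : s < n)
    (hodd : s % 2 = 1) : Special n M a d x := by
  obtain ⟨a1, m2, z1, o1⟩ := h1
  obtain ⟨a2, -, o2, z2⟩ := h2
  have pe : ∀ i, d (i + n) = d i := fun i => by simpa using hper i 1
  have q1 := z1 (n - 1) (by omega) (by omega)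
  have q2 := o2 0 (by omega) (by omega)
  rw [add_zero] at q2
  have hx : d x ≤ M - 1 := by
    have := hmM x; have := hm (x + (n - 1)); have := hM x; omega
  have o1 := o1 hx
  have hx' : M - n + 1 ≤ d (x + s + (n - 1)) := by
    have := hmM (x + s); have := hm (x + s + (n - 1)); have := hM (x + s); omega
  have z2 := z2 hx'
  have sa : s ≤ a := by
    by_contra hh
    have := z1 s (by omega) (by omega)
    omega
  have s1 : s = 1 := by
    by_contra hh
    have b1 := z1 (a + 1) (by omega) (by omega)
    have b2 := o2 (a + 1 - s) (by omega) (by omega)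
    rw [show x + s + (a + 1 - s) = x + (a + 1) by ring] at b2
    omega
  subst s1
  rw [show x + 1 + (n - 1) = x + n by ring, pe] at hx'
  have u1 : ∀ j, 1 ≤ j → j < a → M - j + 1 ≤ d (x + j) := by
    intro j j1 j2
    have := o2 (j - 1) (by omega) (by omega)
    rw [show x + 1 + (j - 1) = x + j by ring] at this
    omega
  have v1 : d (x + a) = M - a := by
    have b1 := o1 a (by omega) (by omega)
    have b2 := z2 (a - 1) (by omega) (by omega)
    rw [show x + 1 + (a - 1) = x + a by ring] at b2
    omega
  refine ⟨a2, m2, ⟨by omega, by omega⟩, v1, ?_, ?_⟩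
  · have : ∀ k : ℕ, ∀ j : ℤ, 1 ≤ j → j < a → j ≤ k → d (x + j) = M := by
      intro k
      induction k with
      | zero => intro j; omega
      | succ k ih =>
        intro j j1 j2 j3
        by_contra hne
        have l1 := u1 j j1 j2
        have l2 := hM (x + j)
        have l3 := ih (j + d (x + j) - M) (by omega) (by omega) (by omega)
        have l4 := hinj (x + j) (x + (j + d (x + j) - M)) (by omega)
        omega
    intro j j1 j2
    exact this j.toNat j j1 j2 (by omega)
  · have : ∀ k : ℕ, ∀ j : ℤ, a < j → j < n → n - j ≤ k → d (x + j) = -a := by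
      intro k
      induction k with
      | zero => intro j; omega
      | succ k ih =>
        intro j j1 j2 j3
        by_contra hne
        have l1 := z1 j j1 j2
        have l2 := hm (x + j)
        have l3 := ih (j + d (x + j) + a) (by omega) (by omega) (by omega)
        have l4 := hinj (x + j) (x + (j + d (x + j) + a)) (by omega)
        omega
    intro j j1 j2
    exact this (n - j).toNat j j1 j2 (by omega)

theorem LG_shift (hper : ∀ i k, d (i + n * k) = d i) (x k : ℤ) (h : LG n M a d x) :
    LG n M a d (x + n * k) := by
  have : ∀ j, d (x + n * k + j) = d (x + j) := by
    intro j
    rw [← hper (x + j) k]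
    congr 1
    ring
  unfold LG
  simp only [this, hper]
  exact h

theorem RG_shift (hper : ∀ i k, d (i + n * k) = d i) (x k : ℤ) (h : RG n M a d x) :
    RG n M a d (x + n * k) := by
  have : ∀ j, d (x + n * k + j) = d (x + j) := by
    intro j
    rw [← hper (x + j) k]
    congr 1
    ring
  unfold RG
  simp only [this]
  exact h

end conflict

theorem shift_exists (n : ℤ) (hn : 0 < n) (he : n % 2 = 0) (x y : ℤ) (h : (x + y) % 2 ≠ 0) :
    ∃ k s, y + n * k = x + s ∧ 1 ≤ s ∧ s < n ∧ s % 2 = 1 := by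
  refine ⟨-((y - x) / n), (y - x) % n, ?_, ?_⟩
  · have := Int.mul_ediv_add_emod (y - x) n
    linarith
  · have h1 := Int.emod_nonneg (y - x) hn.ne'
    have h2 := Int.emod_lt_of_pos (y - x) hn
    have h3 : (y - x) % n % 2 = (y - x) % 2 := Int.emod_emod_of_dvd _ (by omega)
    omega

theorem core (n : ℕ) [NeZero n] (hn : 6 ≤ n) (he : Even n) (π : Equiv.Perm (ZMod n))
    (D : ZMod n → ℤ) (M a : ℤ) (hMa : M + a = n)
    (hres : ∀ r, (D r : ZMod n) = π.symm r - r) (hsum : ∑ r, D r = 0)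
    (hm : ∀ r, -a ≤ D r) (hM : ∀ r, D r ≤ M)
    (hmM : ∀ r, ¬ (D r = -a ∧ D (r + 1) = M)) :
    RoutesIn n π (n - 2) ∨ ∃ x, Special n M a (fun i : ℤ => D (i : ZMod n)) x := by
  by_contra hcon
  push Not at hcon
  obtain ⟨hnr, hns⟩ := hcon
  apply hnr
  obtain ⟨d, hd⟩ : ∃ d : ℤ → ℤ, d = fun i : ℤ => D (i : ZMod n) := ⟨_, rfl⟩
  have hper : ∀ i k, d (i + n * k) = d i := by
    intro i k; simp [hd]
  have hmM' : ∀ x, ¬ (d (x + (n - 1)) = -a ∧ d x = M) := by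
    intro x
    have := hmM ((x : ZMod n) - 1)
    simpa [hd, sub_eq_add_neg] using this
  have hinj : ∀ i j, i + d i = j + d j → i = j := by
    intro i j h
    have h1 : ((i + d i : ℤ) : ZMod n) = ((j + d j : ℤ) : ZMod n) := by rw [h]
    have h2 : (i : ZMod n) = j := by
      simpa [hd, hres] using h1
    have h3 : d i = d j := by simp [hd, h2]
    omega
  have he2 : (n : ℤ) % 2 = 0 := by obtain ⟨k, hk⟩ := he; omega
  have hm' : ∀ r, -a ≤ d r := fun r => by rw [hd]; exact hm _
  have hM' : ∀ r, d r ≤ M := fun r => by rw [hd]; exact hM _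
  rw [← hd] at hns
  have hLL : ∀ x y, LG n M a d x → LG n M a d y → (x + y) % 2 = 0 := by
    intro x y h1 h2
    by_contra hh
    obtain ⟨k, s, e1, s1, s2, s3⟩ := shift_exists n (by omega) he2 x y hh
    have := LG_shift n M a d hper y k h2
    rw [e1] at this
    exact conflLL n M a d hper hMa hmM' hm' hM' x s h1 this s1 s2
  have hRR : ∀ x y, RG n M a d x → RG n M a d y → (x + y) % 2 = 0 := by
    intro x y h1 h2
    by_contra hh
    obtain ⟨k, s, e1, s1, s2, s3⟩ := shift_exists n (by omega) he2 x y hh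
    have := RG_shift n M a d hper y k h2
    rw [e1] at this
    exact conflRR n M a d hper hMa hmM' hm' hM' x s h1 this s1 s2
  have hLR : ∀ x y, LG n M a d x → RG n M a d y → (x + y) % 2 = 0 := by
    intro x y h1 h2
    by_contra hh
    obtain ⟨k, s, e1, s1, s2, s3⟩ := shift_exists n (by omega) he2 x y hh
    have := RG_shift n M a d hper y k h2
    rw [e1] at this
    exact hns x (conflLR n M a d hper hMa hmM' hm' hM' hinj x s h1 this s1 s2 s3)
  have hF : ∀ x, ¬ FF n M a d x := by
    rintro x ⟨a1, m1, o, z⟩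
    have b1 := o 0 (by omega) (by omega)
    have b2 := z (n - 1) (by omega) (by omega)
    have := hmM' x
    have := hm' (x + (n - 1))
    have := hM' x
    rw [add_zero] at b1
    omega
  have : ∃ e, ∀ x, LG n M a d x ∨ RG n M a d x → (x + e) % 2 = 0 := by
    by_cases h : ∃ x, LG n M a d x ∨ RG n M a d x
    · obtain ⟨y, hy⟩ := h
      refine ⟨y, ?_⟩
      intro x hx
      rcases hx with hx | hx <;> rcases hy with hy | hy
      · exact hLL _ _ hx hy
      · exact hLR _ _ hx hy
      · rw [add_comm]; exact hLR _ _ hy hx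
      · exact hRR _ _ hx hy
    · push Not at h
      refine ⟨0, fun x hx => ?_⟩
      have := h x
      tauto
  obtain ⟨e, hp⟩ := this
  rw [hd] at hF hp
  exact lemmaA n hn he π D M a hMa hres hsum hm hM hF e hp

theorem FF_shift (n M a : ℤ) (d : ℤ → ℤ) (hper : ∀ i k, d (i + n * k) = d i) (x k : ℤ)
    (h : FF n M a d x) : FF n M a d (x + n * k) := by
  have : ∀ j, d (x + n * k + j) = d (x + j) := by
    intro j
    rw [← hper (x + j) k]
    congr 1
    ring
  unfold FF
  simp only [this]
  exact h

theorem topk {α : Type*} [Fintype α] [DecidableEq α] (key : α → ℕ) (k : ℕ)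
    (hk : k ≤ Fintype.card α) :
    ∃ S : Finset α, S.card = k ∧ ∀ p ∈ S, ∀ q ∉ S, key q ≤ key p := by
  induction k with
  | zero => exact ⟨∅, by simp, by simp⟩
  | succ k ih =>
    obtain ⟨S, h1, h2⟩ := ih (by omega)
    have hne : (Sᶜ).Nonempty := by
      rw [← Finset.card_pos, Finset.card_compl]
      omega
    obtain ⟨z, hz, hz'⟩ := Finset.exists_max_image (Sᶜ) key hne
    rw [Finset.mem_compl] at hz
    refine ⟨insert z S, by rw [Finset.card_insert_of_notMem hz, h1], ?_⟩
    intro p hp q hq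
    rw [Finset.mem_insert, not_or] at hq
    rw [Finset.mem_insert] at hp
    rcases hp with rfl | hp
    · exact hz' q (by simpa using hq.2)
    · exact h2 p hp q hq.2

theorem rotation_case (n : ℕ) [NeZero n] (hn : 6 ≤ n) (he : Even n) (π : Equiv.Perm (ZMod n))
    (M a : ℤ) (hMa : M + a = n) (hM2 : 2 ≤ M) (ha2 : 2 ≤ a)
    (hπ : ∀ r, π.symm r - r = (M : ZMod n)) : RoutesIn n π (n - 2) := by
  have he2 : (n : ℤ) % 2 = 0 := by obtain ⟨k, hk⟩ := he; omega
  obtain ⟨D, hD⟩ : ∃ D : ZMod n → ℤ, D = fun r : ZMod n =>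
    if r.val = 0 ∨ (2 ≤ r.val ∧ (r.val : ℤ) ≤ a) then M else -a := ⟨_, rfl⟩
  obtain ⟨d, hd⟩ : ∃ d : ℤ → ℤ, d = fun i : ℤ => D (i : ZMod n) := ⟨_, rfl⟩
  have hper : ∀ i k, d (i + n * k) = d i := by
    intro i k; simp [hd]
  have dv : ∀ i : ℤ, 0 ≤ i → i < n → d i = if i = 0 ∨ (2 ≤ i ∧ i ≤ a) then M else -a := by
    intro i h0 h1
    lift i to ℕ using h0
    simp only [hd, hD]
    have : ((i : ℤ) : ZMod n).val = i := by
      rw [Int.cast_natCast, ZMod.val_natCast, Nat.mod_eq_of_lt (by omega)]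
    rw [this]
    norm_cast
  have dv2 : ∀ i : ℤ, n ≤ i → i < 2 * n → d i = if i = n ∨ (n + 2 ≤ i ∧ i ≤ n + a) then M else -a := by
    intro i h0 h1
    have h2 := hper (i - n) 1
    rw [show i - n + (n : ℤ) * 1 = i by ring] at h2
    rw [h2, dv _ (by omega) (by omega)]
    split_ifs <;> omega
  have hMn : (M : ZMod n) = ((-a : ℤ) : ZMod n) := by
    have : M = -a + n := by omega
    rw [this]; simp
  have hsum : ∑ r, D r = 0 := by
    have e1 : ∑ r, D r = ∑ v ∈ Finset.range n, d v := by
      symm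
      refine Finset.sum_bij' (fun v _ => (v : ZMod n)) (fun r _ => r.val) ?_ ?_ ?_ ?_ ?_
      · simp
      · intro r _; simpa using ZMod.val_lt r
      · intro v hv
        simp only [Finset.mem_range] at hv
        rw [ZMod.val_natCast, Nat.mod_eq_of_lt hv]
      · intro r _; simp
      · intro v _; simp [hd]
    rw [e1]
    obtain ⟨A, hA⟩ : ∃ A : ℕ, (A : ℤ) = a := ⟨a.toNat, by omega⟩
    have e2 : ∀ v ∈ Finset.range n, d v = -a + n * (if v ∈ insert 0 (Finset.Icc 2 A) then 1 else 0) := by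
      intro v hv
      simp only [Finset.mem_range] at hv
      rw [dv v (by omega) (by omega)]
      simp only [Finset.mem_insert, Finset.mem_Icc]
      split_ifs <;> omega
    rw [Finset.sum_congr rfl e2, Finset.sum_add_distrib, ← Finset.mul_sum, Finset.sum_ite_mem,
      Finset.inter_eq_right.2]
    · rw [Finset.sum_const, Finset.sum_const, Finset.card_insert_of_notMem (by simp)]
      simp only [Finset.card_range, Nat.card_Icc, nsmul_eq_mul]
      have : ((A + 1 - 2 + 1 : ℕ) : ℤ) = a := by omega
      rw [this]
      ring
    · intro v hv
      simp only [Finset.mem_insert, Finset.mem_Icc] at hv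
      simp only [Finset.mem_range]
      omega
  have hred : ∀ x : ℤ, ∃ k y, y = x + n * k ∧ 0 ≤ y ∧ y < n ∧ y % 2 = x % 2 := by
    intro x
    refine ⟨-(x / n), x % n, ?_, Int.emod_nonneg _ (by omega), Int.emod_lt_of_pos _ (by omega),
      Int.emod_emod_of_dvd _ (by omega)⟩
    have := Int.mul_ediv_add_emod x n
    linarith
  refine lemmaA n hn he π D M a hMa ?_ hsum ?_ ?_ ?_ 0 ?_
  · intro r
    rw [hπ r, hD]
    simp only
    split_ifs
    · rfl
    · rw [hMn]
  · intro r; rw [hD]; simp only; split_ifs <;> omega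
  · intro r; rw [hD]; simp only; split_ifs <;> omega
  · rw [← hd]
    intro x hx
    obtain ⟨k, y, hy, y0, y1, -⟩ := hred x
    have := FF_shift n M a d hper x k hx
    rw [← hy] at this
    obtain ⟨-, -, o, z⟩ := this
    have b1 := o 0 (by omega) (by omega)
    have b2 := z (n - 1) (by omega) (by omega)
    have b3 := o 1 (by omega) (by omega)
    have b4 := o (a - 1) (by omega) (by omega)
    rw [add_zero, dv y y0 y1] at b1
    by_cases hy0 : y = 0
    · subst hy0
      rw [dv _ (by omega) (by omega)] at b3
      split_ifs at * <;> omega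
    by_cases hy2 : y = 2
    · subst hy2
      rw [dv _ (by omega) (by omega)] at b4
      split_ifs at * <;> omega
    rw [dv2 _ (by omega) (by omega)] at b2
    split_ifs at * <;> omega
  · rw [← hd]
    intro x hx
    obtain ⟨k, y, hy, y0, y1, hpar⟩ := hred x
    rw [add_zero, ← hpar]
    by_contra hodd
    have dy := dv y y0 y1
    have dn := dv2 (y + (n - 1)) (by omega) (by omega)
    rcases hx with hx | hx
    · have := LG_shift n M a d hper x k hx
      rw [← hy] at this
      obtain ⟨-, -, z, o⟩ := this
      have b2 := z (n - 1) (by omega) (by omega)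
      have hyy : ¬ (y = 0 ∨ (2 ≤ y ∧ y ≤ a)) := by
        intro hh
        rw [dn] at b2
        split_ifs at * <;> omega
      rw [if_neg hyy] at dy
      have o := o (by omega)
      have b3 := o 1 (by omega) (by omega)
      have b4 := o a (by omega) (by omega)
      have b5 := o 2 (by omega) (by omega)
      by_cases hy1 : y = 1
      · subst hy1
        rw [dv _ (by omega) (by omega)] at b4
        split_ifs at * <;> omega
      by_cases hy2 : y = n - 1
      · rw [dv2 _ (by omega) (by omega)] at b5
        split_ifs at * <;> omega
      rw [dv _ (by omega) (by omega)] at b3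
      split_ifs at * <;> omega
    · have := RG_shift n M a d hper x k hx
      rw [← hy] at this
      obtain ⟨-, -, o, z⟩ := this
      have b1 := o 0 (by omega) (by omega)
      have b4 := o (a - 2) (by omega) (by omega)
      rw [add_zero] at b1
      have hyy : (y = 0 ∨ (2 ≤ y ∧ y ≤ a)) := by
        by_contra hh
        rw [if_neg hh] at dy
        omega
      by_cases hc : d (y + (n - 1)) = -a
      · rw [hc] at dn
        split_ifs at * <;> omega
      have z := z (by split_ifs at dn <;> omega) (n - 2) (by omega) (by omega)
      rw [dv2 _ (by omega) (by omega)] at z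
      by_cases hy3 : y = 3
      · subst hy3
        rw [dv _ (by omega) (by omega)] at b4
        split_ifs at * <;> omega
      split_ifs at * <;> omega

theorem special_case (n : ℕ) [NeZero n] (hn : 6 ≤ n) (he : Even n) (π : Equiv.Perm (ZMod n))
    (D : ZMod n → ℤ) (M a : ℤ) (hMa : M + a = n)
    (hres : ∀ r, (D r : ZMod n) = π.symm r - r) (hsum : ∑ r, D r = 0)
    (hm : ∀ r, -a ≤ D r) (hM : ∀ r, D r ≤ M) (x : ℤ)
    (hs : Special n M a (fun i : ℤ => D (i : ZMod n)) x) :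
    RoutesIn n π (n - 2) := by
  obtain ⟨a2, m2, ⟨x1, x2⟩, xa, ho, hz⟩ := hs
  simp only at x1 x2 xa ho hz
  have cast_inj : ∀ j j' : ℤ, 0 ≤ j → j < n → 0 ≤ j' → j' < n →
      ((x + j : ℤ) : ZMod n) = ((x + j' : ℤ) : ZMod n) → j = j' := by
    intro j j' h1 h2 h3 h4 h
    rw [ZMod.intCast_eq_intCast_iff_dvd_sub] at h
    obtain ⟨k, hk⟩ := h
    have hk' : j' - j = n * k := by linarith
    have : k = 0 := by
      have a1 : k < 1 := by by_contra hh; nlinarith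
      have a2 : -1 < k := by by_contra hh; nlinarith
      omega
    subst this
    omega
  obtain ⟨u, hu⟩ : ∃ u : ZMod n, u = ((x + (a - 1) : ℤ) : ZMod n) := ⟨_, rfl⟩
  obtain ⟨v, hv⟩ : ∃ v : ZMod n, v = ((x + (a + 1) : ℤ) : ZMod n) := ⟨_, rfl⟩
  have Du : D u = M := by rw [hu]; exact ho _ (by omega) (by omega)
  have Dv : D v = -a := by rw [hv]; exact hz _ (by omega) (by omega)
  have hMn : (M : ZMod n) = ((-a : ℤ) : ZMod n) := by
    have : M = -a + n := by omega
    rw [this]; simp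
  obtain ⟨D', hD'⟩ : ∃ D' : ZMod n → ℤ, D' = fun r => D (Equiv.swap u v r) := ⟨_, rfl⟩
  have hres' : ∀ r, (D' r : ZMod n) = π.symm r - r := by
    intro r
    rw [← hres r, hD']
    simp only
    by_cases h1 : r = u
    · rw [h1, Equiv.swap_apply_left, Du, Dv, hMn]
    by_cases h2 : r = v
    · rw [h2, Equiv.swap_apply_right, Du, Dv, hMn]
    rw [Equiv.swap_apply_of_ne_of_ne h1 h2]
  have hsum' : ∑ r, D' r = 0 := by
    rw [hD', Equiv.sum_comp (Equiv.swap u v) D, hsum]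
  obtain ⟨d, hd⟩ : ∃ d : ℤ → ℤ, d = fun i : ℤ => D' (i : ZMod n) := ⟨_, rfl⟩
  have hper : ∀ i k, d (i + n * k) = d i := by
    intro i k; simp [hd]
  have pe : ∀ i, d (i + n) = d i := fun i => by simpa using hper i 1
  have d1 : d (x + (a - 1)) = -a := by
    simp only [hd, hD']
    rw [← hu, Equiv.swap_apply_left, Dv]
  have d2 : d (x + (a + 1)) = M := by
    simp only [hd, hD']
    rw [← hv, Equiv.swap_apply_right, Du]
  have d3 : ∀ j : ℤ, 0 ≤ j → j < n → j ≠ a - 1 → j ≠ a + 1 → d (x + j) = D ((x + j : ℤ) : ZMod n) := by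
    intro j j1 j2 j3 j4
    simp only [hd, hD']
    rw [Equiv.swap_apply_of_ne_of_ne]
    · intro h
      rw [hu] at h
      exact j3 (cast_inj _ _ j1 j2 (by omega) (by omega) h)
    · intro h
      rw [hv] at h
      exact j4 (cast_inj _ _ j1 j2 (by omega) (by omega) h)
  have dx := d3 0 (by omega) (by omega) (by omega) (by omega)
  rw [add_zero] at dx
  have dxa := d3 a (by omega) (by omega) (by omega) (by omega)
  rw [xa] at dxa
  have dM : ∀ j, 1 ≤ j → j < a - 1 → d (x + j) = M := by
    intro j j1 j2
    rw [d3 j (by omega) (by omega) (by omega) (by omega), ho j (by omega) (by omega)]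
  have dm : ∀ j, a + 1 < j → j < n → d (x + j) = -a := by
    intro j j1 j2
    rw [d3 j (by omega) (by omega) (by omega) (by omega), hz j (by omega) (by omega)]
  have hred : ∀ y : ℤ, ∃ k s, y + n * k = x + s ∧ 0 ≤ s ∧ s < n := by
    intro y
    refine ⟨-((y - x) / n), (y - x) % n, ?_, Int.emod_nonneg _ (by omega),
      Int.emod_lt_of_pos _ (by omega)⟩
    have := Int.mul_ediv_add_emod (y - x) n
    linarith
  have hmM : ∀ r, ¬ (D' r = -a ∧ D' (r + 1) = M) := by
    rintro r ⟨h1, h2⟩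
    obtain ⟨y, rfl⟩ := ZMod.intCast_surjective r
    have h1 : d y = -a := by rw [hd]; exact h1
    have h2 : d (y + 1) = M := by rw [hd]; simpa using h2
    obtain ⟨k, s, e1, s0, s1⟩ := hred y
    rw [← hper y k, e1] at h1
    rw [← hper (y + 1) k, show y + 1 + n * k = (y + n * k) + 1 by ring, e1] at h2
    by_cases c1 : s = n - 1
    · rw [show x + s + 1 = x + n by rw [c1]; ring, pe] at h2
      omega
    rw [show x + s + 1 = x + (s + 1) by ring] at h2
    by_cases c2 : s = 0
    · rw [c2, add_zero] at h1; omega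
    by_cases c3 : s < a - 1
    · rw [dM s (by omega) c3] at h1; omega
    by_cases c4 : s = a - 1
    · rw [c4, sub_add_cancel] at h2; omega
    by_cases c5 : s = a
    · rw [c5] at h1; omega
    by_cases c6 : s = a + 1
    · rw [c6] at h1; omega
    rw [dm (s + 1) (by omega) (by omega)] at h2
    omega
  rcases core n hn he π D' M a hMa hres' hsum' (fun r => by rw [hD']; exact hm _)
    (fun r => by rw [hD']; exact hM _) hmM with h | ⟨y, hy⟩
  · exact h
  exfalso
  rw [← hd] at hy
  obtain ⟨-, -, -, ya, yo, yz⟩ := hy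
  obtain ⟨k, s, e1, s0, s1⟩ := hred y
  -- `y ≡ x + s`
  have sh : ∀ j, d (y + j) = d (x + (s + j)) := by
    intro j
    rw [← hper (y + j) k, show y + j + n * k = (y + n * k) + j by ring, e1]
    congr 1
    ring
  by_cases c0 : s = 0
  · have := yo (a - 1) (by omega) (by omega)
    rw [sh, c0, zero_add] at this
    omega
  have c1 : s = n - a := by
    by_contra hne
    by_cases hlt : n - s < a
    · have := yo (n - s) (by omega) hlt
      rw [sh, show x + (s + (n - s)) = x + n by ring, pe] at this
      omega
    · have := yz (n - s) (by omega) (by omega)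
      rw [sh, show x + (s + (n - s)) = x + n by ring, pe] at this
      omega
  have c2 : 2 * a = n := by
    by_contra hne
    by_cases hlt : a < s
    · have := yz (a - s + n) (by omega) (by omega)
      rw [sh, show x + (s + (a - s + n)) = x + a + n by ring, pe] at this
      omega
    · have := yo (a - s) (by omega) (by omega)
      rw [sh, show x + (s + (a - s)) = x + a by ring] at this
      omega
  have := yo 2 (by omega) (by omega)
  rw [sh, dm _ (by omega) (by omega)] at this
  omega

theorem nonrot_case (n : ℕ) [NeZero n] (hn : 6 ≤ n) (he : Even n) (π : Equiv.Perm (ZMod n))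
    (y : ZMod n) (hy : π.symm y - y ≠ π.symm (y - 1) - (y - 1)) : RoutesIn n π (n - 2) := by
  obtain ⟨δ, hδ⟩ : ∃ δ : ZMod n → ℕ, δ = fun r => (π.symm r - r).val := ⟨_, rfl⟩
  have hδn : ∀ r, δ r < n := fun r => by rw [hδ]; exact ZMod.val_lt _
  have hδc : ∀ r, (δ r : ZMod n) = π.symm r - r := fun r => by rw [hδ]; simp
  have hδy : δ y ≠ δ (y - 1) := by
    rw [hδ]
    intro h
    exact hy (ZMod.val_injective n h)
  have hdvd : n ∣ ∑ r, δ r := by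
    rw [← ZMod.natCast_eq_zero_iff]
    push_cast
    simp only [hδc]
    rw [Finset.sum_sub_distrib, Equiv.sum_comp π.symm (fun r => r), sub_self]
  obtain ⟨k, hk⟩ := hdvd
  have hkn : k ≤ n := by
    have : ∑ r, δ r ≤ ∑ r : ZMod n, n := Finset.sum_le_sum (fun r _ => (hδn r).le)
    rw [hk, Finset.sum_const, Finset.card_univ, ZMod.card, smul_eq_mul] at this
    exact Nat.le_of_mul_le_mul_left this (by omega)
  obtain ⟨S, hS, htop⟩ := topk (fun r : ZMod n => n * δ r + (r - y).val) k (by rw [ZMod.card]; exact hkn)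
  have hSne : S.Nonempty := by
    rw [← Finset.card_pos, hS]
    by_contra hh
    have k0 : k = 0 := by omega
    rw [k0, mul_zero, Finset.sum_eq_zero_iff] at hk
    exact hδy (by rw [hk y (Finset.mem_univ _), hk (y - 1) (Finset.mem_univ _)])
  obtain ⟨z, hz, hzmin⟩ := Finset.exists_min_image S δ hSne
  have htop' : ∀ p ∈ S, ∀ q ∉ S, δ q ≤ δ p := by
    intro p hp q hq
    have h1 := htop p hp q hq
    have h2 := ZMod.val_lt (p - y)
    by_contra hh
    have : n * (δ p + 1) ≤ n * δ q := Nat.mul_le_mul_left n (by omega)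
    rw [mul_add, mul_one] at this
    omega
  obtain ⟨D, hD⟩ : ∃ D : ZMod n → ℤ, D = fun r => (δ r : ℤ) - if r ∈ S then (n : ℤ) else 0 := ⟨_, rfl⟩
  have hres : ∀ r, (D r : ZMod n) = π.symm r - r := by
    intro r
    rw [hD, ← hδc]
    simp only
    split_ifs <;> simp
  have hsum : ∑ r, D r = 0 := by
    rw [hD, Finset.sum_sub_distrib, Finset.sum_ite_mem, Finset.univ_inter, Finset.sum_const, hS]
    have : ((∑ r, δ r : ℕ) : ℤ) = n * k := by rw [hk]; push_cast; rfl
    push_cast at this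
    rw [this, nsmul_eq_mul]
    ring
  have hb : ∀ r, -((n : ℤ) - δ z) ≤ D r ∧ D r ≤ δ z := by
    intro r
    have h1 := hδn r
    have h2 := hδn z
    rw [hD]
    simp only
    split_ifs with h
    · have := hzmin r h
      omega
    · have := htop' z hz r h
      omega
  have hmM : ∀ r, ¬ (D r = -((n : ℤ) - δ z) ∧ D (r + 1) = δ z) := by
    rintro r ⟨h1, h2⟩
    have b1 := hδn r
    have b2 := hδn z
    have b3 := hδn (r + 1)
    rw [hD] at h1 h2
    simp only at h1 h2
    have r1 : r ∈ S := by
      by_contra hh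
      rw [if_neg hh] at h1
      omega
    have r2 : r + 1 ∉ S := by
      intro hh
      rw [if_pos hh] at h2
      omega
    rw [if_pos r1] at h1
    rw [if_neg r2] at h2
    have e : δ r = δ (r + 1) := by omega
    have h3 := htop r r1 (r + 1) r2
    rw [e] at h3
    have h4 : (r + 1 - y).val ≤ (r - y).val := by omega
    have hne : r + 1 ≠ y := by
      rintro rfl
      apply hδy
      rw [add_sub_cancel_right, e]
    obtain ⟨s, hs⟩ : ∃ s, s = r - y := ⟨_, rfl⟩
    rw [show r + 1 - y = s + 1 by rw [hs]; ring, ← hs] at h4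
    have hlt : s.val + 1 < n := by
      have := ZMod.val_lt s
      by_contra hh
      have h5 : s.val + 1 = n := by omega
      have h6 : ((s.val + 1 : ℕ) : ZMod n) = 0 := by rw [h5]; simp
      push_cast at h6
      rw [ZMod.natCast_zmod_val, hs] at h6
      exact hne (by rw [← sub_eq_zero, ← h6]; ring)
    have h7 : (s + 1).val = s.val + 1 := by
      have : s + 1 = ((s.val + 1 : ℕ) : ZMod n) := by push_cast; rw [ZMod.natCast_zmod_val]
      rw [this, ZMod.val_natCast, Nat.mod_eq_of_lt hlt]
    omega
  rcases core n hn he π D (δ z) (n - δ z) (by ring) hres hsum (fun r => (hb r).1)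
    (fun r => (hb r).2) hmM with h | ⟨x, hx⟩
  · exact h
  · exact special_case n hn he π D _ _ (by ring) hres hsum (fun r => (hb r).1)
      (fun r => (hb r).2) x hx

theorem stmt16 (n : ℕ) (hn : 6 ≤ n) (he : Even n) (π : Equiv.Perm (ZMod n))
    (h : rt n π = n - 1) :
    π = Equiv.addRight (1 : ZMod n) ∨ π = Equiv.addRight (-1 : ZMod n) := by
  have : NeZero n := ⟨by omega⟩
  have hnr : ∀ k, k < n - 1 → ¬ RoutesIn n π k := by
    intro k hk hr
    have : rt n π ≤ k := Nat.sInf_le hr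
    omega
  by_cases hc : ∃ y : ZMod n, π.symm y - y ≠ π.symm (y - 1) - (y - 1)
  · obtain ⟨y, hy⟩ := hc
    exact absurd (nonrot_case n hn he π y hy) (hnr _ (by omega))
  push Not at hc
  obtain ⟨c, hc0⟩ : ∃ c, c = π.symm 0 := ⟨_, rfl⟩
  have hrot : ∀ i : ℕ, π.symm (i : ZMod n) - i = c := by
    intro i
    induction i with
    | zero => simp [hc0]
    | succ i ih =>
      have := hc ((i + 1 : ℕ) : ZMod n)
      rw [this]
      push_cast
      rw [add_sub_cancel_right]
      exact ih
  have hrot' : ∀ r : ZMod n, π.symm r - r = c := by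
    intro r
    have := hrot r.val
    rwa [ZMod.natCast_zmod_val] at this
  have hπ : ∀ r, π r = r + -c := by
    intro r
    have := hrot' (π r)
    rw [Equiv.symm_apply_apply] at this
    rw [← this]; ring
  have hcv : ((c.val : ℕ) : ZMod n) = c := ZMod.natCast_zmod_val c
  have hlt := ZMod.val_lt c
  by_cases h0 : c.val = 0
  · exfalso
    refine hnr 0 (by omega) ⟨fun _ => π, rfl, ?_, by simp⟩
    have : c = 0 := by rw [← hcv, h0]; simp
    ext r
    rw [hπ, this]; simp
  by_cases h1 : c.val = 1
  · right
    have : c = 1 := by rw [← hcv, h1]; simp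
    ext r
    rw [hπ, this]; simp
  by_cases h2 : c.val = n - 1
  · left
    have : c = -1 := by
      have h3 : ((c.val + 1 : ℕ) : ZMod n) = 0 := by
        rw [h2, show n - 1 + 1 = n by omega]; simp
      push_cast at h3
      rw [hcv] at h3
      exact eq_neg_of_add_eq_zero_left h3
    ext r
    rw [hπ, this]; simp
  refine absurd (rotation_case n hn he π c.val (n - c.val) (by ring) (by omega) (by omega) ?_)
    (hnr _ (by omega))
  intro r
  rw [hrot' r]
  simp
end

section
/- Let n ≥ 6 be even and suppose π is a permutation on C_n admitting a pebble A with window win(A) = (U, A, X, W) of size n − 1 (so exactly one pebble z lies outside the window, π = (z, U, A, X, W) in clockwise order), where every u ∈ U satisfies u ≻ A, every w ∈ W satisfies A ≻ w, every x ∈ X is incomparable with A, and the disbursement is minimized. Then the order structure is: U and W are isolated blocks (no order relations within them), s(z) ≤ 0, U ∪ {A} ∪ X ≻ W, and X decomposes into isolated blocks and blocks with tails; consequently π can be routed in at most n − 2 steps, so rt(C_n, π) ≤ n − 2. -/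
/-- Clockwise distance from `a` to `b` on the cycle `C_n`, as an integer. -/
def dplus (n : ℕ) (a b : ZMod n) : ℤ := ((b - a).val : ℤ)

/-- `p ≻ q` for pebbles with initial positions `π p, π q` and spins `s`. -/
def Bigger (n : ℕ) (π : Equiv.Perm (ZMod n)) (s : ZMod n → ℤ) (p q : ZMod n) : Prop :=
  s p - s q > dplus n (π p) (π q)

/-- `p` and `q` are incomparable. -/
def Incomp (n : ℕ) (π : Equiv.Perm (ZMod n)) (s : ZMod n → ℤ) (p q : ZMod n) : Prop :=
  ¬ Bigger n π s p q ∧ ¬ Bigger n π s q p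

/-- The clockwise offset of pebble `p` from pebble `A` (distance from the
position of `A` to the position of `p`). -/
def offset (n : ℕ) (π : Equiv.Perm (ZMod n)) (A p : ZMod n) : ℕ :=
  (π p - π A).val

/-- Edge `(x-1, x)` is used in round `t`. -/
def Act (e : ℤ) (t : ℕ) (x : ℤ) : Prop := (x + t + e) % 2 = 0

instance (e : ℤ) (t : ℕ) (x : ℤ) : Decidable (Act e t x) := by unfold Act; infer_instance

/-- One round of lifted odd-even transposition. -/
def ystep (e : ℤ) (t : ℕ) (y : ℤ → ℤ) (x : ℤ) : ℤ :=
  if Act e t x then max (y (x - 1)) (y x) else min (y x) (y (x + 1))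

def yt (e : ℤ) (y : ℤ → ℤ) : ℕ → ℤ → ℤ
  | 0 => y
  | t + 1 => ystep e t (yt e y t)

def hstep (e : ℤ) (t : ℕ) (h : ℤ → ℤ) (x : ℤ) : ℤ :=
  if Act e t x then max (h (x - 1) - 1) (h (x + 1)) else h x

def ht (e : ℤ) (h : ℤ → ℤ) : ℕ → ℤ → ℤ
  | 0 => h
  | t + 1 => hstep e t (ht e h t)

/-- `h` is the height function of `y` at threshold `c`. -/
def HasH (c : ℤ) (y h : ℤ → ℤ) : Prop :=
  (∀ x, h x = h (x + 1) + if y x < c then 1 else 0) ∧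
  ∃ K : ℤ, (∀ x, K ≤ x → h x = 0) ∧ (∀ x, x ≤ -K → h x = c - x)

lemma hasH_step (e : ℤ) (t : ℕ) (c : ℤ) (y h : ℤ → ℤ) (H : HasH c y h) :
    HasH c (ystep e t y) (hstep e t h) := by
  obtain ⟨H1, K, H2, H3⟩ := H
  refine ⟨fun x => ?_, K + 1, fun x hx => ?_, fun x hx => ?_⟩
  · by_cases ha : Act e t x
    · have hb : ¬ Act e t (x + 1) := by unfold Act at *; omega
      have h1 := H1 x
      have h2 := H1 (x - 1)
      rw [sub_add_cancel] at h2
      simp only [hstep, ystep, ha, hb, if_true, if_false]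
      split_ifs at * <;> omega
    · have hb : Act e t (x + 1) := by unfold Act at *; omega
      have h1 := H1 x
      have h2 := H1 (x + 1)
      simp only [hstep, ystep, ha, hb, if_true, if_false, add_sub_cancel_right]
      split_ifs at * <;> omega
  · have h1 := H2 x (by omega)
    have h2 := H2 (x - 1) (by omega)
    have h3 := H2 (x + 1) (by omega)
    simp only [hstep]
    split_ifs <;> omega
  · have h1 := H3 x (by omega)
    have h2 := H3 (x - 1) (by omega)
    have h3 := H3 (x + 1) (by omega)
    simp only [hstep]
    split_ifs <;> omega

lemma hasH_t (e c : ℤ) (y h : ℤ → ℤ) (H : HasH c y h) (t : ℕ) :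
    HasH c (yt e y t) (ht e h t) := by
  induction t with
  | zero => exact H
  | succ t ih => exact hasH_step e t c _ _ ih

lemma ht_bound (e c : ℤ) (h : ℤ → ℤ) (T : ℕ)
    (H : ∀ v, ¬ Act e 0 v → |c - v| ≤ T → 2 * h v ≤ T + c - v) (t : ℕ) (htT : t ≤ T) :
    ∀ v, ¬ Act e t v → |c - v| ≤ (T : ℤ) - t → 2 * ht e h t v ≤ (T : ℤ) - t + c - v := by
  induction t with
  | zero => intro v hv hc; simpa [ht] using H v hv (by simpa using hc)
  | succ t ih =>
    intro v hv hc
    have ha : Act e t v := by unfold Act at *; push_cast at *; omega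
    have hl : ¬ Act e t (v - 1) := by unfold Act at *; omega
    have hr : ¬ Act e t (v + 1) := by unfold Act at *; omega
    rw [abs_le] at hc
    push_cast at *
    have h1 := ih (by omega) (v - 1) hl (by rw [abs_le]; omega)
    have h2 := ih (by omega) (v + 1) hr (by rw [abs_le]; omega)
    simp only [ht, hstep, ha, if_true]
    omega

lemma final_zero (e c : ℤ) (h : ℤ → ℤ) (T : ℕ) (hT : 1 ≤ T)
    (H : ∀ v, ¬ Act e 0 v → |c - v| ≤ T → 2 * h v ≤ T + c - v) : ht e h T c ≤ 0 := by
  by_cases ha : Act e T c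
  · obtain ⟨T', rfl⟩ : ∃ T', T = T' + 1 := ⟨T - 1, by omega⟩
    have hb : ¬ Act e T' c := by unfold Act at *; push_cast at *; omega
    have := ht_bound e c h (T' + 1) H T' (by omega) c hb (by simp)
    simp only [ht, hstep, hb, if_false]
    push_cast at this
    omega
  · have := ht_bound e c h T H T le_rfl c ha (by simp)
    omega

lemma hasH_sorted (c : ℤ) (y h : ℤ → ℤ) (H : HasH c y h) (h0 : h c ≤ 0) :
    (∀ x, c ≤ x → c ≤ y x) ∧ (∀ x, x < c → y x < c) := by
  obtain ⟨H1, K, H2, H3⟩ := H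
  have anti : ∀ (k : ℕ) x, h (x + k) ≤ h x ∧ h x ≤ h (x + k) + k := by
    intro k
    induction k with
    | zero => intro x; simp
    | succ k ih =>
      intro x
      have h1 := ih x
      have h2 := H1 (x + k)
      push_cast
      rw [← add_assoc]
      split_ifs at h2 <;> omega
  have anti' : ∀ x x', x ≤ x' → h x' ≤ h x ∧ h x ≤ h x' + (x' - x) := by
    intro x x' hx
    have := anti (x' - x).toNat x
    rw [Int.toNat_of_nonneg (by omega)] at this
    simpa using this
  constructor
  · intro x hx
    by_contra hlt
    have h1 := anti' c x hx
    have h2 := H1 x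
    have h3 := anti' (x + 1) (max (x + 1) K) (by omega)
    have h4 := H2 (max (x + 1) K) (by omega)
    rw [if_pos (by omega)] at h2
    omega
  · intro x hx
    by_contra hlt
    have h1 := anti' (x + 1) c (by omega)
    have h2 := H1 x
    have h3 := anti' (min x (-K)) x (by omega)
    have h4 := H3 (min x (-K)) (by omega)
    rw [if_neg (by omega)] at h2
    omega

lemma yt_sorted (e : ℤ) (y : ℤ → ℤ) (T : ℕ) (hT : 1 ≤ T)
    (H : ∀ c, ∃ h, HasH c y h ∧ ∀ v, ¬ Act e 0 v → |c - v| ≤ T → 2 * h v ≤ T + c - v) :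
    ∀ x, yt e y T x = x := by
  have key : ∀ c, (∀ x, c ≤ x → c ≤ yt e y T x) ∧ (∀ x, x < c → yt e y T x < c) := by
    intro c
    obtain ⟨h, h1, h2⟩ := H c
    exact hasH_sorted c _ _ (hasH_t e c y h h1 T) (final_zero e c h T hT h2)
  intro x
  have h1 := (key x).1 x le_rfl
  have h2 := (key (x + 1)).2 x (by omega)
  omega

/-- The permutation `σ` is encoded by the lifted sequence `y`. -/
def Compat (n : ℕ) (α : ZMod n) (y : ℤ → ℤ) (σ : Equiv.Perm (ZMod n)) : Prop :=
  (∀ x, y (x + n) = y x + n) ∧ ∀ x : ℤ, σ ((y x : ZMod n) + α) = (x : ZMod n) + α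

lemma per_mul (n : ℕ) (y : ℤ → ℤ) (h : ∀ x, y (x + n) = y x + n) (k x : ℤ) :
    y (x + n * k) = y x + n * k := by
  induction k using Int.induction_on with
  | zero => simp
  | succ i ih =>
    have := h (x + n * i)
    rw [ih] at this
    rw [show x + (n : ℤ) * (i + 1) = x + n * i + n by ring, this]; ring
  | pred i ih =>
    have := h (x + n * (-i - 1))
    rw [show x + (n : ℤ) * (-i - 1) + n = x + n * (-i) by ring, ih] at this
    linarith

lemma compat_step (n : ℕ) (he : Even n) (α : ZMod n) (e : ℤ) (t : ℕ)
    (y : ℤ → ℤ) (σ : Equiv.Perm (ZMod n)) (h : Compat n α y σ) [NeZero n] :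
    ∃ τ, CycleStep n σ τ ∧ Compat n α (ystep e t y) τ := by
  classical
  obtain ⟨m, hm⟩ := he
  obtain ⟨hp, hc⟩ := h
  set M : Finset (ZMod n) := Finset.univ.filter
    (fun i => ∃ x : ℤ, (x : ZMod n) + α = i ∧ Act e t (x + 1) ∧ y (x + 1) < y x) with hM
  have memM : ∀ x : ℤ, ((x : ZMod n) + α ∈ M ↔ Act e t (x + 1) ∧ y (x + 1) < y x) := by
    intro x
    simp only [hM, Finset.mem_filter, Finset.mem_univ, true_and]
    constructor
    · rintro ⟨x', h1, h2, h3⟩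
      have h4 : (x' : ZMod n) = (x : ZMod n) := add_right_cancel h1
      rw [ZMod.intCast_eq_intCast_iff_dvd_sub] at h4
      obtain ⟨k, hk⟩ := h4
      have hx : x = x' + n * k := by linarith
      have e1 := per_mul n y hp k x'
      have e2 := per_mul n y hp k (x' + 1)
      subst hx
      rw [show x' + (n : ℤ) * k + 1 = x' + 1 + n * k by ring, e1, e2]
      refine ⟨?_, by omega⟩
      unfold Act at *
      have : (n : ℤ) * k = 2 * (m * k) := by rw [hm]; push_cast; ring
      rw [this]; omega
    · intro h; exact ⟨x, rfl, h⟩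
  have lift : ∀ i : ZMod n, ∃ x : ℤ, (x : ZMod n) + α = i := by
    intro i
    obtain ⟨x, hx⟩ := ZMod.intCast_surjective (i - α)
    exact ⟨x, by rw [hx]; ring⟩
  have cast1 : ∀ x : ℤ, (x : ZMod n) + α + 1 = ((x + 1 : ℤ) : ZMod n) + α := by
    intro x; push_cast; ring
  have cast2 : ∀ x : ℤ, (x : ZMod n) + α - 1 = ((x - 1 : ℤ) : ZMod n) + α := by
    intro x; push_cast; ring
  have hMm : ∀ i ∈ M, i + 1 ∉ M := by
    intro i hi hi'
    obtain ⟨x, rfl⟩ := lift i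
    rw [cast1, memM] at hi'
    rw [memM] at hi
    obtain ⟨h1, _⟩ := hi
    obtain ⟨h2, _⟩ := hi'
    unfold Act at *; omega
  set g : ZMod n → ZMod n := fun i => if i ∈ M then i + 1 else if i - 1 ∈ M then i - 1 else i with hg
  have hinv : Function.Involutive g := by
    intro i
    by_cases h1 : i ∈ M
    · have h2 := hMm i h1
      simp [hg, h1, h2]
    · by_cases h2 : i - 1 ∈ M
      · simp [hg, h1, h2]
      · simp [hg, h1, h2]
  refine ⟨σ.trans hinv.toPerm, ⟨M, hMm, fun p => rfl⟩, ?_, ?_⟩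
  · intro x
    have h1 := hp x
    have h2 := hp (x - 1)
    have h3 := hp (x + 1)
    rw [show x - 1 + (n : ℤ) = x + n - 1 by ring] at h2
    rw [show x + 1 + (n : ℤ) = x + n + 1 by ring] at h3
    have ha : Act e t (x + n) ↔ Act e t x := by unfold Act; rw [hm]; push_cast; omega
    simp only [ystep, ha, h1, h2, h3]
    split_ifs <;> omega
  · intro x
    change g (σ _) = _
    by_cases ha : Act e t x
    · have hb : ¬ Act e t (x + 1) := by unfold Act at *; omega
      have hx : (x : ZMod n) + α ∉ M := by rw [memM]; tauto
      simp only [ystep, ha, if_true]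
      by_cases hlt : y x < y (x - 1)
      · rw [max_eq_left hlt.le, hc]
        have : ((x - 1 : ℤ) : ZMod n) + α ∈ M := by
          rw [memM, sub_add_cancel]; exact ⟨ha, hlt⟩
        simp only [hg, this, if_true]
        rw [cast1, sub_add_cancel]
      · rw [max_eq_right (by omega), hc]
        have : (x : ZMod n) + α - 1 ∉ M := by
          rw [cast2, memM, sub_add_cancel]; tauto
        simp only [hg, this, hx, if_false]
    · have hb : Act e t (x + 1) := by unfold Act at *; omega
      have hx : (x : ZMod n) + α - 1 ∉ M := by rw [cast2, memM, sub_add_cancel]; tauto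
      simp only [ystep, ha, if_false]
      by_cases hlt : y (x + 1) < y x
      · rw [min_eq_right hlt.le, hc]
        have h1 : (x : ZMod n) + α ∈ M := by rw [memM]; exact ⟨hb, hlt⟩
        have h2 : ((x + 1 : ℤ) : ZMod n) + α ∉ M := by rw [← cast1]; exact hMm _ h1
        have h3 : ((x + 1 : ℤ) : ZMod n) + α - 1 = (x : ZMod n) + α := by push_cast; ring
        simp only [hg, h2, h3, h1, if_true, if_false]
      · rw [min_eq_left (by omega), hc]
        have h1 : (x : ZMod n) + α ∉ M := by rw [memM]; tauto
        simp only [hg, hx, h1, if_false]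

lemma routes_of_sorted (n : ℕ) [NeZero n] (he : Even n) (α : ZMod n) (e : ℤ) (y : ℤ → ℤ) (k : ℕ) :
    ∀ (t : ℕ) (σ : Equiv.Perm (ZMod n)), Compat n α (yt e y t) σ →
      (∀ x, yt e y (t + k) x = x) → RoutesIn n σ k := by
  induction k with
  | zero =>
    intro t σ hc hs
    have : σ = 1 := by
      ext i
      obtain ⟨x, hx⟩ := ZMod.intCast_surjective (i - α)
      have h1 := hc.2 x
      rw [show yt e y t x = x from hs x, hx] at h1
      simpa using congrArg (fun z : ZMod n => z) h1
    exact ⟨fun _ => σ, rfl, this, fun t ht => absurd ht (Nat.not_lt_zero t)⟩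
  | succ k ih =>
    intro t σ hc hs
    obtain ⟨τ, h1, h2⟩ := compat_step n he α e t _ σ hc
    obtain ⟨f, f0, fk, fs⟩ := ih (t + 1) τ h2 (by rwa [show t + 1 + k = t + (k + 1) by ring])
    refine ⟨fun j => Nat.casesOn j σ f, rfl, fk, ?_⟩
    intro j hj
    cases j with
    | zero => change CycleStep n σ (f 0); rw [f0]; exact h1
    | succ j => exact fs j (by omega)

/-- Lifted destination of the pebble at position `x` (relative to base `α`). -/
def YY (n : ℕ) (π : Equiv.Perm (ZMod n)) (s : ZMod n → ℤ) (α : ZMod n) (x : ℤ) : ℤ :=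
  x + s (π.symm ((x : ZMod n) + α))

lemma YY_per (n : ℕ) (π : Equiv.Perm (ZMod n)) (s : ZMod n → ℤ) (α : ZMod n) (x : ℤ) :
    YY n π s α (x + n) = YY n π s α x + n := by
  simp only [YY]; push_cast; simp; ring

lemma YY_cast (n : ℕ) (π : Equiv.Perm (ZMod n)) (s : ZMod n → ℤ) (α : ZMod n)
    (hs : ∀ i, (s i : ZMod n) = i - π i) (x : ℤ) :
    (YY n π s α x : ZMod n) + α = π.symm ((x : ZMod n) + α) := by
  simp only [YY]; push_cast; rw [hs]; simp; ring

lemma YY_compat (n : ℕ) (π : Equiv.Perm (ZMod n)) (s : ZMod n → ℤ) (α : ZMod n)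
    (hs : ∀ i, (s i : ZMod n) = i - π i) : Compat n α (YY n π s α) π :=
  ⟨YY_per n π s α, fun x => by rw [YY_cast n π s α hs]; simp⟩

lemma YY_inj (n : ℕ) [NeZero n] (π : Equiv.Perm (ZMod n)) (s : ZMod n → ℤ) (α : ZMod n)
    (hs : ∀ i, (s i : ZMod n) = i - π i) (x x' : ℤ)
    (h : YY n π s α x = YY n π s α x') : x = x' := by
  have h1 := YY_cast n π s α hs x
  rw [h, YY_cast n π s α hs x'] at h1
  simp only [YY] at h
  rw [h1] at h
  omega

lemma sum_window {β : Type*} [AddCommMonoid β] (n : ℕ) [NeZero n] (v : ℤ) (G : ZMod n → β) :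
    ∑ i ∈ Finset.range n, G ((v + i : ℤ) : ZMod n) = ∑ z, G z := by
  refine Finset.sum_bij' (fun i _ => ((v + i : ℤ) : ZMod n)) (fun z _ => (z - v).val)
    ?_ ?_ ?_ ?_ ?_
  · intros; simp
  · intro z _; simpa using ZMod.val_lt _
  · intro i hi
    simp only [Finset.mem_range] at hi
    push_cast
    rw [add_sub_cancel_left]
    exact ZMod.val_cast_of_lt hi
  · intro z _
    push_cast
    simp
  · intros; rfl

lemma sum_div (n : ℕ) [NeZero n] (π : Equiv.Perm (ZMod n)) (s : ZMod n → ℤ) (α : ZMod n)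
    (hs : ∀ i, (s i : ZMod n) = i - π i) (hsum : ∑ i, s i = 0) (v c : ℤ) :
    ∑ i ∈ Finset.range n, (YY n π s α (v + i) - c) / n = v - c := by
  have hn : (n : ℤ) ≠ 0 := by exact_mod_cast NeZero.ne n
  have h1 : ∑ i ∈ Finset.range n, (YY n π s α (v + i) - c) % n
      = ∑ i ∈ Finset.range n, (i : ℤ) := by
    have a1 := sum_window n v (fun z => (((π.symm (z + α) - α - c : ZMod n)).val : ℤ))
    have a2 := sum_window n 0 (fun z => (z.val : ℤ))
    have a3 : ∑ z : ZMod n, (((π.symm (z + α) - α - c : ZMod n)).val : ℤ)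
        = ∑ z : ZMod n, (z.val : ℤ) :=
      Equiv.sum_comp (((Equiv.addRight α).trans π.symm).trans
        ((Equiv.subRight α).trans (Equiv.subRight (c : ZMod n)))) (fun z : ZMod n => (z.val : ℤ))
    rw [a3, ← a2] at a1
    have e1 : ∀ i ∈ Finset.range n, (YY n π s α (v + i) - c) % n =
        (((π.symm (((v + i : ℤ) : ZMod n) + α) - α - c : ZMod n)).val : ℤ) := by
      intro i _
      rw [← YY_cast n π s α hs, add_sub_cancel_right, ← Int.cast_sub, ZMod.val_intCast]
    have e2 : ∀ i ∈ Finset.range n, (i : ℤ) = ((((0 + i : ℤ) : ZMod n)).val : ℤ) := by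
      intro i hi
      simp only [Finset.mem_range] at hi
      rw [zero_add, Int.cast_natCast, ZMod.val_cast_of_lt hi]
    rw [Finset.sum_congr rfl e1, Finset.sum_congr rfl e2]
    exact a1
  have h2 : ∑ i ∈ Finset.range n, (YY n π s α (v + i) - c)
      = n * (v - c) + ∑ i ∈ Finset.range n, (i : ℤ) := by
    have a1 := sum_window n v (fun z => s (π.symm (z + α)))
    have a3 : ∑ z : ZMod n, s (π.symm (z + α)) = 0 := by
      rw [← hsum]
      exact Equiv.sum_comp ((Equiv.addRight α).trans π.symm) s
    rw [a3] at a1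
    have : ∀ i ∈ Finset.range n, YY n π s α (v + i) - c =
      (v - c) + (i : ℤ) + s (π.symm (((v + i : ℤ) : ZMod n) + α)) := by
      intro i _; simp only [YY]; ring
    rw [Finset.sum_congr rfl this, Finset.sum_add_distrib, Finset.sum_add_distrib, a1]
    simp
    ring
  have h3 : ∑ i ∈ Finset.range n, (YY n π s α (v + i) - c)
      = n * ∑ i ∈ Finset.range n, (YY n π s α (v + i) - c) / n
        + ∑ i ∈ Finset.range n, (YY n π s α (v + i) - c) % n := by
    rw [Finset.mul_sum, ← Finset.sum_add_distrib]
    exact Finset.sum_congr rfl fun i _ => (Int.mul_ediv_add_emod _ _).symm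
  rw [h1] at h3
  have : (n : ℤ) * ∑ i ∈ Finset.range n, (YY n π s α (v + i) - c) / n = n * (v - c) := by linarith
  exact mul_left_cancel₀ hn this

def h0 (n : ℕ) (y : ℤ → ℤ) (c v : ℤ) : ℤ :=
  ∑ i ∈ Finset.range n, max 0 (-((y (v + i) - c) / n))

lemma spread_bound (n : ℕ) [NeZero n] (s : ZMod n → ℤ) (hsum : ∑ i, s i = 0)
    (hmin : ∀ p q, s p - s q ≤ n) (p : ZMod n) : -(n : ℤ) ≤ s p ∧ s p ≤ n := by
  constructor
  · by_contra hlt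
    have : ∑ i, s i < ∑ i : ZMod n, (0 : ℤ) :=
      Finset.sum_lt_sum_of_nonempty Finset.univ_nonempty fun i _ => by
        have := hmin i p; omega
    simp [hsum] at this
  · by_contra hlt
    have : ∑ i : ZMod n, (0 : ℤ) < ∑ i, s i :=
      Finset.sum_lt_sum_of_nonempty Finset.univ_nonempty fun i _ => by
        have := hmin p i; omega
    simp [hsum] at this

lemma h0_hasH (n : ℕ) [NeZero n] (π : Equiv.Perm (ZMod n)) (s : ZMod n → ℤ) (α : ZMod n)
    (hs : ∀ i, (s i : ZMod n) = i - π i) (hsum : ∑ i, s i = 0)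
    (hmin : ∀ p q, s p - s q ≤ n) (c : ℤ) :
    HasH c (YY n π s α) (h0 n (YY n π s α) c) := by
  have hn : (0 : ℤ) < n := by exact_mod_cast NeZero.pos n
  have hb : ∀ x, x - n ≤ YY n π s α x ∧ YY n π s α x ≤ x + n := by
    intro x
    have := spread_bound n s hsum hmin (π.symm ((x : ZMod n) + α))
    simp only [YY]; omega
  refine ⟨fun x => ?_, |c| + 2 * n, fun x hx => ?_, fun x hx => ?_⟩
  · set y := YY n π s α with hy
    set F : ℕ → ℤ := fun i => max 0 (-((y (x + i) - c) / n)) with hF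
    have e1 : h0 n y c x = ∑ i ∈ Finset.range n, F i := rfl
    have e2 : h0 n y c (x + 1) = ∑ i ∈ Finset.range n, F (i + 1) := by
      simp only [h0, hF]
      refine Finset.sum_congr rfl fun i _ => ?_
      push_cast; rw [add_assoc x 1, add_comm (1 : ℤ)]
    have e3 := Finset.sum_range_succ F n
    have e4 := Finset.sum_range_succ' F n
    have e5 : F n = max 0 (-((y x - c) / n + 1)) := by
      simp only [hF]
      rw [hy, YY_per, show YY n π s α x + n - c = YY n π s α x - c + n * 1 by ring,
        Int.add_mul_ediv_left _ _ hn.ne']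
    have e6 : F 0 = max 0 (-((y x - c) / n)) := by simp [hF]
    rw [e1, e2]
    have e7 : (y x - c) / (n : ℤ) < 0 ↔ y x < c := by
      rw [Int.ediv_lt_iff_lt_mul hn]; omega
    split_ifs with hlt
    · have := e7.2 hlt; omega
    · have := mt e7.1 hlt; omega
  · apply Finset.sum_eq_zero
    intro i _
    have := hb (x + i)
    have h1 := le_abs_self c
    have : 0 ≤ (YY n π s α (x + i) - c) / n := Int.ediv_nonneg (by omega) hn.le
    omega
  · rw [show c - x = -(x - c) by ring, ← sum_div n π s α hs hsum x c, ← Finset.sum_neg_distrib]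
    apply Finset.sum_congr rfl
    intro i hi
    simp only [Finset.mem_range] at hi
    have := hb (x + i)
    have h1 := neg_abs_le c
    have : (YY n π s α (x + i) - c) / n ≤ 0 := by
      have : (YY n π s α (x + i) - c) / n < 1 := by
        rw [Int.ediv_lt_iff_lt_mul hn]; omega
      omega
    omega

/-- Two uncrossed residues in the window starting at `v`. -/
def TwoZ (n : ℕ) (y : ℤ → ℤ) (v c : ℤ) : Prop :=
  ∀ x1 x2, v ≤ x1 → x1 < v + n → v ≤ x2 → x2 < v + n → c + n ≤ y x1 → y x2 < c →
    ∃ x x', v ≤ x ∧ x < x' ∧ x' < v + n ∧ c ≤ y x ∧ y x < c + n ∧ c ≤ y x' ∧ y x' < c + n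

lemma h0_bound (n : ℕ) [NeZero n] (π : Equiv.Perm (ZMod n)) (s : ZMod n → ℤ) (α : ZMod n)
    (hs : ∀ i, (s i : ZMod n) = i - π i) (hsum : ∑ i, s i = 0)
    (hmin : ∀ p q, s p - s q ≤ n) (hn2 : 2 ≤ n) (c v : ℤ) (hcv : |c - v| ≤ ((n - 2 : ℕ) : ℤ))
    (hz : TwoZ n (YY n π s α) v c) :
    2 * h0 n (YY n π s α) c v ≤ ((n - 2 : ℕ) : ℤ) + c - v := by
  have hn : (0 : ℤ) < n := by exact_mod_cast NeZero.pos n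
  have hsd := sum_div n π s α hs hsum v c
  have hmin' : ∀ x x', YY n π s α x - YY n π s α x' ≤ x - x' + n := by
    intro x x'
    have := hmin (π.symm ((x : ZMod n) + α)) (π.symm ((x' : ZMod n) + α))
    simp only [YY]; omega
  set y := YY n π s α with hy
  rw [abs_le] at hcv
  have hcast : ((n - 2 : ℕ) : ℤ) = n - 2 := by omega
  rw [hcast] at *
  have q0 : ∀ x, 0 ≤ (y x - c) / (n : ℤ) ↔ c ≤ y x := by
    intro x; rw [Int.le_ediv_iff_mul_le hn]; omega
  have q1 : ∀ x, 1 ≤ (y x - c) / (n : ℤ) ↔ c + n ≤ y x := by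
    intro x; rw [Int.le_ediv_iff_mul_le hn]; omega
  have q2 : ∀ x, 2 ≤ (y x - c) / (n : ℤ) ↔ c + 2 * n ≤ y x := by
    intro x; rw [Int.le_ediv_iff_mul_le hn]; omega
  have qm : ∀ x, -1 ≤ (y x - c) / (n : ℤ) ↔ c - n ≤ y x := by
    intro x; rw [Int.le_ediv_iff_mul_le hn]; omega
  by_cases hA : ∀ i ∈ Finset.range n, 0 ≤ (y (v + i) - c) / (n : ℤ)
  · have : h0 n y c v = 0 := Finset.sum_eq_zero fun i hi => by have := hA i hi; omega
    omega
  by_cases hB : ∀ i ∈ Finset.range n, (y (v + i) - c) / (n : ℤ) ≤ 0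
  · have : h0 n y c v = -(v - c) := by
      rw [← hsd, ← Finset.sum_neg_distrib]
      exact Finset.sum_congr rfl fun i hi => by have := hB i hi; omega
    omega
  push Not at hA hB
  obtain ⟨i2, hi2, hA⟩ := hA
  obtain ⟨i1, hi1, hB⟩ := hB
  simp only [Finset.mem_range] at hi1 hi2
  have g1 := (q1 (v + i1)).1 (by omega)
  have g2 : y (v + i2) < c := by
    have := mt (q0 (v + i2)).2 (by omega); omega
  obtain ⟨x, x', a1, a2, a3, a4, a5, a6, a7⟩ :=
    hz (v + i1) (v + i2) (by omega) (by omega) (by omega) (by omega) g1 g2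
  have habs : 2 * h0 n y c v = (∑ i ∈ Finset.range n, |(y (v + i) - c) / (n : ℤ)|) - (v - c) := by
    rw [← hsd, h0, Finset.mul_sum, ← Finset.sum_sub_distrib]
    refine Finset.sum_congr rfl fun i _ => ?_
    rcases abs_cases ((y (v + i) - c) / (n : ℤ)) with h | h <;> omega
  have hle : (∑ i ∈ Finset.range n, |(y (v + i) - c) / (n : ℤ)|) ≤
      ∑ i ∈ Finset.range n, ((1 : ℤ) - (if i = (x - v).toNat then 1 else 0)
        - (if i = (x' - v).toNat then 1 else 0)) := by
    apply Finset.sum_le_sum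
    intro i hi
    simp only [Finset.mem_range] at hi
    have b1 : -1 ≤ (y (v + i) - c) / (n : ℤ) := by
      rw [qm]; have := hmin' (v + i1) (v + i); omega
    have b2 : (y (v + i) - c) / (n : ℤ) ≤ 1 := by
      by_contra hc
      have := (q2 (v + i)).1 (by omega)
      have := hmin' (v + i) (v + i2); omega
    have b3 : ∀ w, c ≤ y w → y w < c + n → (y w - c) / (n : ℤ) = 0 := by
      intro w h1 h2
      have h3 := (q0 w).2 h1
      have h4 := mt (q1 w).1 (by omega)
      omega
    split_ifs with h1 h2 h2
    · omega
    · rw [show v + (i : ℤ) = x by omega, b3 x a4 a5]; simp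
    · rw [show v + (i : ℤ) = x' by omega, b3 x' a6 a7]; simp
    · rw [abs_le]; omega
  have hev : ∑ i ∈ Finset.range n, ((1 : ℤ) - (if i = (x - v).toNat then 1 else 0)
        - (if i = (x' - v).toNat then 1 else 0)) = n - 2 := by
    rw [Finset.sum_sub_distrib, Finset.sum_sub_distrib, Finset.sum_ite_eq', Finset.sum_ite_eq',
      if_pos (by simp only [Finset.mem_range]; omega),
      if_pos (by simp only [Finset.mem_range]; omega)]
    simp; ring
  omega

lemma main_route (n : ℕ) [NeZero n] (hn3 : 3 ≤ n) (he : Even n)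
    (π : Equiv.Perm (ZMod n)) (s : ZMod n → ℤ) (α : ZMod n)
    (hs : ∀ i, (s i : ZMod n) = i - π i) (hsum : ∑ i, s i = 0)
    (hmin : ∀ p q, s p - s q ≤ n) (e : ℤ)
    (hz : ∀ v c : ℤ, (v + e) % 2 = 1 → -(n : ℤ) < v → v ≤ 0 → TwoZ n (YY n π s α) v c) :
    rt n π ≤ n - 2 := by
  apply Nat.sInf_le
  refine routes_of_sorted n he α e (YY n π s α) (n - 2) 0 π (YY_compat n π s α hs) ?_
  rw [zero_add]
  apply yt_sorted e _ _ (by omega)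
  intro c
  refine ⟨_, h0_hasH n π s α hs hsum hmin c, fun v hv hcv => ?_⟩
  refine h0_bound n π s α hs hsum hmin (by omega) c v hcv ?_
  have hn : (0 : ℤ) < n := by omega
  have hper := per_mul n (YY n π s α) (YY_per n π s α)
  obtain ⟨m, hm⟩ := he
  -- translate
  set k : ℤ := -((-v) / n) with hk
  have d1 := Int.mul_ediv_add_emod (-v) n
  have d2 := Int.emod_nonneg (-v) hn.ne'
  have d3 := Int.emod_lt_of_pos (-v) hn
  have hnk : (n : ℤ) * k = -(n * ((-v) / n)) := by rw [hk]; ring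
  have hpar : (n : ℤ) * k = 2 * (m * k) := by rw [hm]; push_cast; ring
  have hv' : (v - n * k + e) % 2 = 1 := by
    unfold Act at hv; push_cast at hv; rw [hpar]; omega
  have key := hz (v - n * k) (c - n * k) hv' (by omega) (by omega)
  intro x1 x2 r1 r2 r3 r4 r5 r6
  have t1 := hper (-k) x1
  have t2 := hper (-k) x2
  rw [mul_neg] at t1 t2
  obtain ⟨x, x', w1, w2, w3, w4, w5, w6, w7⟩ := key (x1 + -(n * k)) (x2 + -(n * k)) (by omega)
    (by omega) (by omega) (by omega) (by omega) (by omega)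
  have t3 := hper k x
  have t4 := hper k x'
  exact ⟨x + n * k, x' + n * k, by omega, by omega, by omega, by omega, by omega, by omega,
    by omega⟩

lemma big_iff (n : ℕ) [NeZero n] (π : Equiv.Perm (ZMod n)) (s : ZMod n → ℤ) (α : ZMod n)
    (x x' : ℤ) (h1 : x ≤ x') (h2 : x' < x + n) :
    Bigger n π s (π.symm ((x : ZMod n) + α)) (π.symm ((x' : ZMod n) + α)) ↔
      YY n π s α x' < YY n π s α x := by
  have : dplus n (π (π.symm ((x : ZMod n) + α))) (π (π.symm ((x' : ZMod n) + α))) = x' - x := by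
    simp only [dplus, Equiv.apply_symm_apply, add_sub_add_right_eq_sub]
    rw [← Int.cast_sub, ZMod.val_intCast, Int.emod_eq_of_lt (by omega) (by omega)]
  simp only [Bigger, this, YY]
  omega

lemma off_eq (n : ℕ) [NeZero n] (π : Equiv.Perm (ZMod n)) (A p : ZMod n) :
    p = π.symm (((offset n π A p : ℤ) : ZMod n) + π A) := by
  rw [Equiv.eq_symm_apply]
  simp [offset]

lemma off_lt (n : ℕ) [NeZero n] (π : Equiv.Perm (ZMod n)) (A p : ZMod n) :
    offset n π A p < n := ZMod.val_lt _

lemma off_symm (n : ℕ) [NeZero n] (π : Equiv.Perm (ZMod n)) (A : ZMod n) (x : ℕ) (hx : x < n) :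
    offset n π A (π.symm (((x : ℤ) : ZMod n) + π A)) = x := by
  simp only [offset, Equiv.apply_symm_apply, add_sub_cancel_right, Int.cast_natCast]
  exact ZMod.val_cast_of_lt hx

lemma count_sum (a b : ℕ) (k : ℕ) :
    ∑ i ∈ Finset.range k, ((if a + 1 ≤ i ∧ i ≤ a + b then (-1 : ℤ) else 0) +
      (if a + b + 2 ≤ i then 1 else 0)) =
      -((min k (a + b + 1) : ℕ) - (min k (a + 1) : ℕ) : ℤ) + (k - (min k (a + b + 2) : ℕ) : ℤ) := by
  induction k with
  | zero => simp
  | succ k ih =>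
    rw [Finset.sum_range_succ, ih]
    split_ifs <;> omega

/-- The explicit structure of the lifted permutation. -/
structure Str (n u a b : ℕ) (y : ℤ → ℤ) : Prop where
  A : y 0 = (b : ℤ) - u
  U : ∀ x, -(u : ℤ) ≤ x → x ≤ -1 → y x = b + 1 + x
  W : ∀ x, (a : ℤ) + 1 ≤ x → x ≤ a + b → y x = x - a - u - 1
  X : ∀ x, 1 ≤ x → x ≤ (a : ℤ) → (b : ℤ) + 1 ≤ y x ∧ y x ≤ a + b + 1
  Z : (b : ℤ) + 1 ≤ y (a + b + 1) ∧ y (a + b + 1) ≤ (a : ℤ) + b + 1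

lemma str_of (n : ℕ) [NeZero n] 
    (π : Equiv.Perm (ZMod n)) (s : ZMod n → ℤ)
    (hs : ∀ i, (s i : ZMod n) = i - π i)
    (hsum : ∑ i, s i = 0)
    (hmin : ∀ p q, s p - s q ≤ n)
    (A : ZMod n) (u a b : ℕ) (hu : 1 ≤ u) (hb : 1 ≤ b)
    (hsize : u + a + b + 2 = n)
    (hX : ∀ p, 1 ≤ offset n π A p → offset n π A p ≤ a → Incomp n π s A p)
    (hW : ∀ p, a + 1 ≤ offset n π A p → offset n π A p ≤ a + b → Bigger n π s A p)
    (hz : ∀ p, offset n π A p = a + b + 1 → Incomp n π s A p)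
    (hU : ∀ p, a + b + 2 ≤ offset n π A p → Bigger n π s p A) :
    Str n u a b (YY n π s (π A)) := by
  have hn : (0 : ℤ) < n := by omega
  have hA0 : A = π.symm (((0 : ℤ) : ZMod n) + π A) := by simp
  have hAn : A = π.symm (((n : ℤ) : ZMod n) + π A) := by simp
  have hmin' : ∀ x x', YY n π s (π A) x - YY n π s (π A) x' ≤ x - x' + n := by
    intro x x'
    have := hmin (π.symm ((x : ZMod n) + π A)) (π.symm ((x' : ZMod n) + π A))
    simp only [YY]; omega
  have hinj := YY_inj n π s (π A) hs
  have hper := YY_per n π s (π A)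
  have hsd := sum_div n π s (π A) hs hsum
  have bigA : ∀ x : ℕ, x < n → (Bigger n π s A (π.symm (((x : ℤ) : ZMod n) + π A)) ↔
      YY n π s (π A) x < YY n π s (π A) 0) := by
    intro x hx
    have := big_iff n π s (π A) 0 x (by omega) (by omega)
    rwa [← hA0] at this
  have bigA' : ∀ x : ℕ, 0 < x → x < n → (Bigger n π s (π.symm (((x : ℤ) : ZMod n) + π A)) A ↔
      YY n π s (π A) n < YY n π s (π A) x) := by
    intro x hx0 hx
    have := big_iff n π s (π A) x n (by omega) (by omega)
    rwa [← hAn] at this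
  set y := YY n π s (π A) with hy
  have hyn : y n = y 0 + n := by have := hper 0; rwa [zero_add] at this
  have inc : ∀ x : ℕ, 0 < x → x < n → Incomp n π s A (π.symm (((x : ℤ) : ZMod n) + π A)) →
      y 0 < y x ∧ y x < y 0 + n := by
    intro x h1 h2 h3
    have g1 := mt (bigA x h2).2 h3.1
    have g2 := mt (bigA' x h1 h2).2 h3.2
    have g3 : y 0 ≠ y x := fun h => by have := hinj _ _ h; omega
    have g4 : y n ≠ y x := fun h => by have := hinj _ _ h; omega
    omega
  have fX : ∀ x : ℕ, 1 ≤ x → x ≤ a → y 0 < y x ∧ y x < y 0 + n := fun x h1 h2 =>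
    inc x h1 (by omega) (hX _ (by rw [off_symm n π A x (by omega)]; omega)
      (by rw [off_symm n π A x (by omega)]; omega))
  have fZ : ∀ x : ℕ, x = a + b + 1 → y 0 < y x ∧ y x < y 0 + n := fun x h1 =>
    inc x (by omega) (by omega) (hz _ (by rw [off_symm n π A x (by omega)]; omega))
  have fW : ∀ x : ℕ, a + 1 ≤ x → x ≤ a + b → y x < y 0 := fun x h1 h2 =>
    (bigA x (by omega)).1 (hW _ (by rw [off_symm n π A x (by omega)]; omega)
      (by rw [off_symm n π A x (by omega)]; omega))
  have fU : ∀ x : ℕ, a + b + 2 ≤ x → x < n → y 0 + n < y x := fun x h1 h2 => by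
    rw [← hyn]
    exact (bigA' x (by omega) h2).1 (hU _ (by rw [off_symm n π A x (by omega)]; omega))
  -- the spin of A
  have hyA : y 0 = (b : ℤ) - u := by
    have h1 := hsd 0 (y 0)
    have h2 : ∑ i ∈ Finset.range n, (y (0 + i) - y 0) / n =
        ∑ i ∈ Finset.range n, ((if a + 1 ≤ i ∧ i ≤ a + b then (-1 : ℤ) else 0) +
      (if a + b + 2 ≤ i then 1 else 0)) := by
      apply Finset.sum_congr rfl
      intro i hi
      simp only [Finset.mem_range] at hi
      rw [zero_add]
      have m1 := hmin' 0 i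
      have m2 := hmin' i 0
      have ev : ∀ q : ℤ, q * n ≤ y i - y 0 → y i - y 0 < (q + 1) * n →
          (y i - y 0) / (n : ℤ) = q := by
        intro q h1 h2
        have h3 := (Int.le_ediv_iff_mul_le hn).2 h1
        have h4 := (Int.ediv_lt_iff_lt_mul hn).2 h2
        omega
      split_ifs with c1 c2 c2
      · omega
      · have := fW i c1.1 c1.2
        rw [ev (-1) (by omega) (by omega)]; rfl
      · have := fU i c2 hi
        rw [ev 1 (by omega) (by omega)]; rfl
      · have : y 0 ≤ y i ∧ y i < y 0 + n := by
          rcases Nat.eq_zero_or_pos i with h | h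
          · subst h; simp; omega
          · by_cases h' : i ≤ a
            · have := fX i h h'; omega
            · have := fZ i (by omega); omega
        rw [ev 0 (by omega) (by omega)]; rfl
    rw [h2, count_sum] at h1
    omega
  have fU' : ∀ x : ℤ, -(u : ℤ) ≤ x → x ≤ -1 → y 0 < y x := by
    intro x h1 h2
    have h3 := fU (x + n).toNat (by omega) (by omega)
    rw [Int.toNat_of_nonneg (by omega), hper] at h3
    omega
  have fW' : ∀ x : ℤ, (a : ℤ) + 1 ≤ x → x ≤ a + b → y x < y 0 := by
    intro x h1 h2
    have h3 := fW x.toNat (by omega) (by omega)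
    rwa [Int.toNat_of_nonneg (by omega)] at h3
  have u1 := fU' (-u) (by omega) (by omega)
  have wb := fW' (a + b) (by omega) (by omega)
  have indU : ∀ i : ℕ, i < u → y (-(u : ℤ) + i) = b + 1 + (-(u : ℤ) + i) := by
    intro i
    induction i using Nat.strong_induction_on with
    | _ i ih =>
      intro hi
      have h1 := fU' (-(u : ℤ) + i) (by omega) (by omega)
      have h2 := hmin' (-(u : ℤ) + i) (a + b)
      by_contra hne
      have h3 := ih (y (-(u : ℤ) + i) - (b + 1 - u)).toNat (by omega) (by omega)
      rw [Int.toNat_of_nonneg (by omega)] at h3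
      have h4 := hinj (-(u : ℤ) + i) (-(u : ℤ) + (y (-(u : ℤ) + i) - (b + 1 - u))) (by omega)
      omega
  have indW : ∀ i : ℕ, i < b → y ((a : ℤ) + b - i) = ((a : ℤ) + b - i) - a - u - 1 := by
    intro i
    induction i using Nat.strong_induction_on with
    | _ i ih =>
      intro hi
      have h1 := fW' ((a : ℤ) + b - i) (by omega) (by omega)
      have h2 := hmin' (-u) ((a : ℤ) + b - i)
      by_contra hne
      have h3 := ih ((b : ℤ) - u - 1 - y ((a : ℤ) + b - i)).toNat (by omega) (by omega)
      rw [Int.toNat_of_nonneg (by omega)] at h3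
      have h4 := hinj ((a : ℤ) + b - i) ((a : ℤ) + b - ((b : ℤ) - u - 1 - y ((a : ℤ) + b - i)))
        (by omega)
      omega
  have sU : ∀ x, -(u : ℤ) ≤ x → x ≤ -1 → y x = b + 1 + x := by
    intro x h1 h2
    have := indU (x + u).toNat (by omega)
    rw [Int.toNat_of_nonneg (by omega), show -(u : ℤ) + (x + u) = x by ring] at this
    exact this
  have sW : ∀ x, (a : ℤ) + 1 ≤ x → x ≤ a + b → y x = x - a - u - 1 := by
    intro x h1 h2
    have := indW (a + b - x).toNat (by omega)
    rw [Int.toNat_of_nonneg (by omega), show (a : ℤ) + b - (a + b - x) = x by ring] at this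
    exact this
  have lowU : ∀ x, 0 < x → y 0 < y x → (b : ℤ) + 1 ≤ y x := by
    intro x h1 h2
    by_contra h3
    have h4 := sU (y x - b - 1) (by omega) (by omega)
    have h5 := hinj x (y x - b - 1) (by omega)
    omega
  refine ⟨hyA, sU, sW, ?_, ?_⟩
  · intro x h1 h2
    have h3 := fX x.toNat (by omega) (by omega)
    rw [Int.toNat_of_nonneg (by omega)] at h3
    have h4 := hmin' x (a + b)
    exact ⟨lowU x (by omega) h3.1, by omega⟩
  · have h3 := fZ (a + b + 1) rfl
    push_cast at h3
    refine ⟨lowU _ (by omega) h3.1, ?_⟩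
    by_contra h4
    have h5 := sW (y (a + b + 1) - n + a + u + 1) (by omega) (by omega)
    have h6 := hper (y (a + b + 1) - n + a + u + 1)
    have h7 := hinj (a + b + 1) (y (a + b + 1) - n + a + u + 1 + n) (by omega)
    omega

/-- Location of each position in `(-n, n)`. -/
lemma str_cases (n u a b : ℕ) (y : ℤ → ℤ) (S : Str n u a b y)
    (hper : ∀ x, y (x + n) = y x + n) (hsize : u + a + b + 2 = n)
    (x : ℤ) (h1 : -(n : ℤ) < x) (h2 : x < n) :
    (x = 0 ∧ y x = (b : ℤ) - u) ∨
    (-(u : ℤ) ≤ x ∧ x ≤ -1 ∧ y x = b + 1 + x) ∨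
    ((a : ℤ) + b + 2 ≤ x ∧ y x = b + 1 + x) ∨
    ((a : ℤ) + 1 ≤ x ∧ x ≤ a + b ∧ y x = x - a - u - 1) ∨
    ((a : ℤ) + 1 - n ≤ x ∧ x ≤ a + b - n ∧ y x = x - a - u - 1) ∨
    (1 ≤ x ∧ x ≤ (a : ℤ) ∧ (b : ℤ) + 1 ≤ y x ∧ y x ≤ a + b + 1) ∨
    (x ≤ (a : ℤ) - n ∧ (b : ℤ) + 1 - n ≤ y x ∧ y x ≤ a + b + 1 - n) ∨
    (x = (a : ℤ) + b + 1 ∧ (b : ℤ) + 1 ≤ y x ∧ y x ≤ a + b + 1) ∨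
    (x = (a : ℤ) + b + 1 - n ∧ (b : ℤ) + 1 - n ≤ y x ∧ y x ≤ a + b + 1 - n) := by
  have hp := hper x
  have hp' := hper (x - n)
  rw [sub_add_cancel] at hp'
  have SA := S.A
  have SZ := S.Z
  by_cases c0 : x = 0
  · left; subst c0; exact ⟨rfl, SA⟩
  by_cases c1 : x = (a : ℤ) + b + 1
  · rw [← c1] at SZ
    iterate 7 right
    left; exact ⟨c1, by omega, by omega⟩
  by_cases c2 : x + n = (a : ℤ) + b + 1
  · rw [← c2] at SZ
    iterate 8 right
    exact ⟨by omega, by omega, by omega⟩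
  by_cases c3 : 0 < x
  · by_cases d1 : x ≤ a
    · have := S.X x (by omega) d1
      iterate 5 right
      left; exact ⟨by omega, d1, this⟩
    · by_cases d2 : x ≤ a + b
      · have := S.W x (by omega) d2
        iterate 3 right
        left; exact ⟨by omega, d2, this⟩
      · have := S.U (x - n) (by omega) (by omega)
        iterate 2 right
        left; exact ⟨by omega, by omega⟩
  · by_cases d0 : -(u : ℤ) ≤ x
    · have := S.U x d0 (by omega)
      right; left; exact ⟨d0, by omega, this⟩
    · by_cases d1 : x + n ≤ a
      · have := S.X (x + n) (by omega) d1
        iterate 6 right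
        left; exact ⟨by omega, by omega, by omega⟩
      · have := S.W (x + n) (by omega) (by omega)
        iterate 4 right
        left; exact ⟨by omega, by omega, by omega⟩

set_option maxHeartbeats 1000000 in
lemma two_a (n u a b : ℕ) (y : ℤ → ℤ) (S : Str n u a b y)
    (hper : ∀ x, y (x + n) = y x + n) (hsize : u + a + b + 2 = n) (he : Even n)
    (hu : 1 ≤ u) (hb : 1 ≤ b) (ha : 1 ≤ a) (v c : ℤ) (hv : (v + (a + 1)) % 2 = 1)
    (h1 : -(n : ℤ) < v) (h2 : v ≤ 0) : TwoZ n y v c := by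
  obtain ⟨m, hm⟩ := he
  intro x1 x2 r1 r2 r3 r4 r5 r6
  have k1 := str_cases n u a b y S hper hsize x1 (by omega) (by omega)
  have k2 := str_cases n u a b y S hper hsize x2 (by omega) (by omega)
  have SA := S.A
  have SU := S.U (-1) (by omega) (by omega)
  have SW := S.W (a + 1) (by omega) (by omega)
  have SX := S.X a (by omega) (by omega)
  have SZ := S.Z
  have pX := hper (a - n)
  have pZ := hper (a + b + 1 - n)
  rw [sub_add_cancel] at pX pZ
  by_cases g1 : -(u : ℤ) ≤ v
  · have b1 : c ≤ b := by rcases k1 with k | k | k | k | k | k | k | k | k <;> omega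
    have b2 : -(u : ℤ) < c := by rcases k2 with k | k | k | k | k | k | k | k | k <;> omega
    clear k1 k2 r5 r6
    exact ⟨a, a + b + 1, by omega, by omega, by omega, by omega, by omega, by omega, by omega⟩
  have b1 : c + n ≤ a + b + 1 := by rcases k1 with k | k | k | k | k | k | k | k | k <;> omega
  by_cases g2 : v = -(u : ℤ) - 1
  · have b2 : (b : ℤ) + 1 - n < c := by rcases k2 with k | k | k | k | k | k | k | k | k <;> omega
    clear k1 k2 r5 r6
    exact ⟨-1, 0, by omega, by omega, by omega, by omega, by omega, by omega, by omega⟩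
  have b2 : -(u : ℤ) - n < c := by rcases k2 with k | k | k | k | k | k | k | k | k <;> omega
  clear k1 k2 r5 r6
  by_cases g3 : (a : ℤ) + 1 - n ≤ v
  · by_cases g6 : (b : ℤ) < c + n
    · exact ⟨-1, 0, by omega, by omega, by omega, by omega, by omega, by omega, by omega⟩
    by_cases g4 : (b : ℤ) - u < c + n
    · exact ⟨a + b + 1 - n, 0, by omega, by omega, by omega, by omega, by omega, by omega, by omega⟩
    · exact ⟨a + b + 1 - n, a + 1, by omega, by omega, by omega, by omega, by omega, by omega,
        by omega⟩
  · by_cases g4 : c + n ≤ (b : ℤ) - u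
    · exact ⟨a - n, a + b + 1 - n, by omega, by omega, by omega, by omega, by omega, by omega,
        by omega⟩
    by_cases g5 : c + n ≤ (b : ℤ) + 1
    · exact ⟨a + b + 1 - n, 0, by omega, by omega, by omega, by omega, by omega, by omega, by omega⟩
    · exact ⟨-1, 0, by omega, by omega, by omega, by omega, by omega, by omega, by omega⟩

/-- Modified spins for the case `X = ∅`. -/
def sMod (n : ℕ) (π : Equiv.Perm (ZMod n)) (s : ZMod n → ℤ) (α : ZMod n) (p : ZMod n) : ℤ :=
  s p + (if p = π.symm (((1 : ℤ) : ZMod n) + α) then (n : ℤ) else 0)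
    - (if p = π.symm (((-1 : ℤ) : ZMod n) + α) then (n : ℤ) else 0)

lemma sMod_cases (n : ℕ) [NeZero n] (hn : 3 ≤ n) (π : Equiv.Perm (ZMod n)) (s : ZMod n → ℤ)
    (α : ZMod n) (x : ℤ) (h1 : -(n : ℤ) < x) (h2 : x < n) :
    ((x = 1 ∨ x = 1 - n) ∧ YY n π (sMod n π s α) α x = YY n π s α x + n) ∨
    ((x = -1 ∨ x = n - 1) ∧ YY n π (sMod n π s α) α x = YY n π s α x - n) ∨
    (x ≠ 1 ∧ x ≠ 1 - n ∧ x ≠ -1 ∧ x ≠ n - 1 ∧ YY n π (sMod n π s α) α x = YY n π s α x) := by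
  have key : ∀ w : ℤ, -1 ≤ w → w ≤ 1 → (π.symm ((x : ZMod n) + α) = π.symm ((w : ZMod n) + α) ↔
      (x = w ∨ x = w + n ∨ x = w - n)) := by
    intro w hw1 hw2
    rw [Equiv.apply_eq_iff_eq, add_left_inj, ZMod.intCast_eq_intCast_iff_dvd_sub]
    constructor
    · rintro ⟨k, hk⟩
      have hk1 : k < 2 := by
        by_contra h
        have : (n : ℤ) * 2 ≤ n * k := mul_le_mul_of_nonneg_left (by omega) (by omega)
        omega
      have hk2 : -2 < k := by
        by_contra h
        have : (n : ℤ) * k ≤ n * (-2) := mul_le_mul_of_nonneg_left (by omega) (by omega)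
        omega
      have : k = -1 ∨ k = 0 ∨ k = 1 := by omega
      rcases this with rfl | rfl | rfl <;> omega
    · rintro (h | h | h)
      · exact ⟨0, by rw [h]; ring⟩
      · exact ⟨-1, by rw [h]; ring⟩
      · exact ⟨1, by rw [h]; ring⟩
  simp only [YY, sMod, key 1 (by omega) (by omega), key (-1) (by omega) (by omega)]
  split_ifs <;> omega

/-- The explicit structure of the modified lifted permutation. -/
lemma str_cases0 (n u b : ℕ) [NeZero n] (π : Equiv.Perm (ZMod n)) (s : ZMod n → ℤ)
    (α : ZMod n) (S : Str n u 0 b (YY n π s α)) (hsize : u + 0 + b + 2 = n)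
    (hu : 1 ≤ u) (hb : 1 ≤ b) (y : ℤ → ℤ) (hy : y = YY n π (sMod n π s α) α)
    (x : ℤ) (h1 : -(n : ℤ) < x) (h2 : x < n) :
    (x = 0 ∧ y x = (b : ℤ) - u) ∨
    (x = -1 ∧ y x = -(u : ℤ) - 2) ∨
    (x = n - 1 ∧ y x = b) ∨
    (-(u : ℤ) ≤ x ∧ x ≤ -2 ∧ y x = b + 1 + x) ∨
    ((b : ℤ) + 2 ≤ x ∧ x ≤ n - 2 ∧ y x = b + 1 + x) ∨
    (x = 1 ∧ y x = (b : ℤ) + 2) ∨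
    (x = 1 - n ∧ y x = -(u : ℤ)) ∨
    (2 ≤ x ∧ x ≤ b ∧ y x = x - u - 1) ∨
    (2 - (n : ℤ) ≤ x ∧ x ≤ b - n ∧ y x = x - u - 1) ∨
    (x = (b : ℤ) + 1 ∧ y x = b + 1) ∨
    (x = (b : ℤ) + 1 - n ∧ y x = -(u : ℤ) - 1) := by
  subst hy
  have k1 := sMod_cases n (by omega) π s α x h1 h2
  have k2 := str_cases n u 0 b _ S (YY_per n π s α) hsize x h1 h2
  push_cast at k2
  rcases k1 with k | k | k <;>
    rcases k2 with l | l | l | l | l | l | l | l | l <;> first | (exfalso; omega) | skip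
  all_goals
    first
    | (left; exact ⟨by omega, by omega⟩)
    | (right; left; exact ⟨by omega, by omega⟩)
    | (iterate 2 right
       left; exact ⟨by omega, by omega⟩)
    | (iterate 3 right
       left; exact ⟨by omega, by omega, by omega⟩)
    | (iterate 4 right
       left; exact ⟨by omega, by omega, by omega⟩)
    | (iterate 5 right
       left; exact ⟨by omega, by omega⟩)
    | (iterate 6 right
       left; exact ⟨by omega, by omega⟩)
    | (iterate 7 right
       left; exact ⟨by omega, by omega, by omega⟩)
    | (iterate 8 right
       left; exact ⟨by omega, by omega, by omega⟩)
    | (iterate 9 right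
       left; exact ⟨by omega, by omega⟩)
    | (iterate 10 right
       exact ⟨by omega, by omega⟩)
    | omega

set_option maxHeartbeats 1000000 in
lemma two_0 (n u b : ℕ) [NeZero n] (π : Equiv.Perm (ZMod n)) (s : ZMod n → ℤ)
    (α : ZMod n) (S : Str n u 0 b (YY n π s α)) (hsize : u + 0 + b + 2 = n)
    (hn : 6 ≤ n) (he : Even n) (hu : 1 ≤ u) (hb : 1 ≤ b) (v c : ℤ)
    (hv : (v + (if b = 1 then 1 else 0)) % 2 = 1)
    (h1 : -(n : ℤ) < v) (h2 : v ≤ 0) : TwoZ n (YY n π (sMod n π s α) α) v c := by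
  obtain ⟨m, hm⟩ := he
  have K := str_cases0 n u b π s α S hsize hu hb _ rfl
  set y := YY n π (sMod n π s α) α with hy
  intro x1 x2 r1 r2 r3 r4 r5 r6
  have k1 := K x1 (by omega) (by omega)
  have k2 := K x2 (by omega) (by omega)
  have y0 : y 0 = (b : ℤ) - u := by have := K 0 (by omega) (by omega); omega
  have ym1 : y (-1) = -(u : ℤ) - 2 := by have := K (-1) (by omega) (by omega); omega
  have y1 : y 1 = (b : ℤ) + 2 := by have := K 1 (by omega) (by omega); omega
  have yz : y (b + 1) = (b : ℤ) + 1 := by have := K (b + 1) (by omega) (by omega); omega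
  have b3 : -(u : ℤ) ≤ v → c ≤ b := by
    intro g; rcases k1 with k | k | k | k | k | k | k | k | k | k | k <;> omega
  have b4 : -(u : ℤ) - 1 ≤ v → -(u : ℤ) - 2 < c := by
    intro g; rcases k2 with k | k | k | k | k | k | k | k | k | k | k <;> omega
  have b5 : v ≤ -(u : ℤ) - 1 → c + n ≤ b + 2 := by
    intro g; rcases k1 with k | k | k | k | k | k | k | k | k | k | k <;> omega
  have b6 : v = 1 - n → c + n ≤ b := by
    intro g; rcases k1 with k | k | k | k | k | k | k | k | k | k | k <;> omega
  have b7 : v < -(u : ℤ) - 1 → 1 < b → -(u : ℤ) < c + n := by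
    intro g g'; rcases k2 with k | k | k | k | k | k | k | k | k | k | k <;> omega
  have b8 : v = 0 → b = 1 → -(u : ℤ) - 1 < c := by
    intro g g2; rcases k2 with k | k | k | k | k | k | k | k | k | k | k <;> omega
  clear k1 k2 r5 r6
  by_cases hb1 : b = 1
  · have ym2 : y (-2) = (b : ℤ) - 1 := by have := K (-2) (by omega) (by omega); omega
    clear K
    rw [if_pos hb1] at hv
    subst hb1
    by_cases g1 : -(u : ℤ) ≤ v
    · have b3 := b3 g1
      have b4 := b4 (by omega)
      have hc : -(u : ℤ) < c ∨ c = -u ∨ c = -u - 1 := by omega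
      rcases hc with hc | hc | hc
      · exact ⟨1, ((1 : ℕ) : ℤ) + 1, by omega, by omega, by omega, by omega, by omega, by omega, by omega⟩
      · exact ⟨0, ((1 : ℕ) : ℤ) + 1, by omega, by omega, by omega, by omega, by omega, by omega, by omega⟩
      · by_cases hv0 : v = 0
        · have b8 := b8 hv0 rfl
          exfalso; omega
        · exact ⟨-2, 0, by omega, by omega, by omega, by omega, by omega, by omega, by omega⟩
    · have b5 := b5 (by omega)
      have b4 := b4 (by omega)
      exact ⟨-2, 0, by omega, by omega, by omega, by omega, by omega, by omega, by omega⟩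
  · have y2 : y 2 = 1 - (u : ℤ) := by have := K 2 (by omega) (by omega); omega
    have y1n : y (1 - n) = - (u : ℤ) := by have := K (1 - n) (by omega) (by omega); omega
    have yzn : y (b + 1 - n) = -(u : ℤ) - 1 := by
      have := K (b + 1 - n) (by omega) (by omega); omega
    clear K
    rw [if_neg hb1] at hv
    by_cases g1 : -(u : ℤ) ≤ v
    · have b3 := b3 g1
      have b4 := b4 (by omega)
      have hc : -(u : ℤ) < c ∨ c = -u ∨ c = -u - 1 := by omega
      rcases hc with hc | hc | hc
      · exact ⟨1, b + 1, by omega, by omega, by omega, by omega, by omega, by omega, by omega⟩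
      · exact ⟨0, b + 1, by omega, by omega, by omega, by omega, by omega, by omega, by omega⟩
      · exact ⟨0, 2, by omega, by omega, by omega, by omega, by omega, by omega, by omega⟩
    have b5 := b5 (by omega)
    by_cases g2 : v = -(u : ℤ) - 1
    · have b4 := b4 (by omega)
      exact ⟨0, 2, by omega, by omega, by omega, by omega, by omega, by omega, by omega⟩
    have b7 := b7 (by omega) (by omega)
    by_cases g3 : v = 1 - n
    · have b6 := b6 g3
      exact ⟨1 - n, b + 1 - n, by omega, by omega, by omega, by omega, by omega, by omega, by omega⟩
    have hc : c + n ≤ b ∨ c + n = b + 1 ∨ c + n = b + 2 := by omega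
    rcases hc with hc | hc | hc
    · exact ⟨b + 1 - n, -1, by omega, by omega, by omega, by omega, by omega, by omega, by omega⟩
    · exact ⟨b + 1 - n, 0, by omega, by omega, by omega, by omega, by omega, by omega, by omega⟩
    · exact ⟨0, 2, by omega, by omega, by omega, by omega, by omega, by omega, by omega⟩

lemma route_0 (n u b : ℕ) [NeZero n] (π : Equiv.Perm (ZMod n)) (s : ZMod n → ℤ)
    (A : ZMod n) (S : Str n u 0 b (YY n π s (π A))) (hsize : u + 0 + b + 2 = n)
    (hs : ∀ i, (s i : ZMod n) = i - π i) (hsum : ∑ i, s i = 0)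
    (hn : 6 ≤ n) (he : Even n) (hu : 1 ≤ u) (hb : 1 ≤ b) : rt n π ≤ n - 2 := by
  refine main_route n (by omega) he π (sMod n π s (π A)) (π A) ?_ ?_ ?_
    (if b = 1 then 1 else 0) ?_
  · intro i
    rw [← hs]
    simp only [sMod]
    push_cast
    split_ifs <;> simp
  · simp only [sMod]
    rw [Finset.sum_sub_distrib, Finset.sum_add_distrib, hsum, Finset.sum_ite_eq',
      Finset.sum_ite_eq']
    simp
  · have key : ∀ p, -(u : ℤ) - 1 ≤ sMod n π s (π A) p ∧ sMod n π s (π A) p ≤ b + 1 := by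
      intro p
      have h1 := off_lt n π A p
      have h2 := off_eq n π A p
      have K := str_cases0 n u b π s (π A) S hsize hu hb _ rfl (offset n π A p) (by omega)
        (by omega)
      have h3 : YY n π (sMod n π s (π A)) (π A) (offset n π A p) =
          offset n π A p + sMod n π s (π A) p := by
        rw [YY, ← h2]
      rw [h3] at K
      rcases K with k | k | k | k | k | k | k | k | k | k | k <;> omega
    intro p q
    have := key p
    have := key q
    omega
  · intro v c h1 h2 h3
    exact two_0 n u b π s (π A) S hsize hn he hu hb v c h1 h2 h3

/-- Extremal window type 2 (Lemmas 10 and 11).  Let `n ≥ 6` be even and let `s`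
be a minimized valid disbursement of `π` with a pebble `A` whose window is
`win(A) = (U, A, X, W)` of size `n − 1`: reading clockwise from `A` (by offsets),
the pebbles at offsets `1, …, a` form `X` (incomparable with `A`), those at
offsets `a+1, …, a+b` form `W` (smaller than `A`), the pebble `z` at offset
`a+b+1` is outside the window (incomparable with `A`), and the pebbles at
offsets `a+b+2, …, n−1` form `U` (bigger than `A`); so `π = (z, U, A, X, W)`
clockwise, with `U, W` nonempty.  Then: `U` and `W` are isolated blocks,
`s(z) ≤ 0`, `U ∪ {A} ∪ X ≻ W`, `X` decomposes into consecutive blocks each of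
which is an isolated block or a block with a tail; consequently
`rt(C_n, π) ≤ n − 2`. -/
theorem stmt18 (n : ℕ) [NeZero n] (hn : 6 ≤ n) (he : Even n)
    (π : Equiv.Perm (ZMod n)) (s : ZMod n → ℤ)
    (hval : ∀ i, s i = dplus n (π i) i ∨ s i = dplus n (π i) i - n)
    (hsum : ∑ i, s i = 0)
    (hmin : ∀ p q, s p - s q ≤ n)
    (A : ZMod n) (u a b : ℕ) (hu : 1 ≤ u) (hb : 1 ≤ b)
    (hsize : u + a + b + 2 = n)
    (hX : ∀ p, 1 ≤ offset n π A p → offset n π A p ≤ a → Incomp n π s A p)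
    (hW : ∀ p, a + 1 ≤ offset n π A p → offset n π A p ≤ a + b → Bigger n π s A p)
    (hz : ∀ p, offset n π A p = a + b + 1 → Incomp n π s A p)
    (hU : ∀ p, a + b + 2 ≤ offset n π A p → Bigger n π s p A) :
    -- U is an isolated block
    (∀ p q, a + b + 2 ≤ offset n π A p → a + b + 2 ≤ offset n π A q →
      ¬ Bigger n π s p q) ∧
    -- W is an isolated block
    (∀ p q, a + 1 ≤ offset n π A p → offset n π A p ≤ a + b →
      a + 1 ≤ offset n π A q → offset n π A q ≤ a + b → ¬ Bigger n π s p q) ∧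
    -- s(z) ≤ 0
    (∀ p, offset n π A p = a + b + 1 → s p ≤ 0) ∧
    -- U ∪ {A} ∪ X ≻ W
    (∀ p q, (offset n π A p ≤ a ∨ a + b + 2 ≤ offset n π A p) →
      a + 1 ≤ offset n π A q → offset n π A q ≤ a + b → Bigger n π s p q) ∧
    -- X decomposes into isolated blocks and blocks with tails
    (∃ (k : ℕ) (c : ℕ → ℕ), c 0 = 0 ∧ c k = a ∧ (∀ i, i < k → c i < c (i + 1)) ∧
      ∀ i, i < k →
        ((∀ p q, c i + 1 ≤ offset n π A p → offset n π A p ≤ c (i + 1) →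
            c i + 1 ≤ offset n π A q → offset n π A q ≤ c (i + 1) →
            ¬ Bigger n π s p q) ∨
         (∀ p q, c i + 1 ≤ offset n π A p → offset n π A p ≤ c (i + 1) →
            c i + 1 ≤ offset n π A q → offset n π A q ≤ c (i + 1) →
            (Bigger n π s p q ↔
              offset n π A q = c (i + 1) ∧ offset n π A p ≠ c (i + 1))))) ∧
    -- consequently π routes in at most n − 2 rounds
    rt n π ≤ n - 2 := by
  have hs : ∀ i, (s i : ZMod n) = i - π i := by
    intro i
    rcases hval i with h | h <;> rw [h] <;> simp [dplus]
  have S := str_of n π s hs hsum hmin A u a b hu hb hsize hX hW hz hU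
  have hper := YY_per n π s (π A)
  have hoff : ∀ p, YY n π s (π A) (offset n π A p) = offset n π A p + s p := by
    intro p; rw [YY, ← off_eq n π A p]
  have hd : ∀ p q, 0 ≤ dplus n (π p) (π q) := fun p q => Int.natCast_nonneg _
  have sU : ∀ p, a + b + 2 ≤ offset n π A p → s p = b + 1 := by
    intro p h1
    have h2 := off_lt n π A p
    have h3 := S.U ((offset n π A p : ℤ) - n) (by omega) (by omega)
    have h4 := hper ((offset n π A p : ℤ) - n)
    rw [sub_add_cancel, hoff p] at h4
    omega
  have sW : ∀ p, a + 1 ≤ offset n π A p → offset n π A p ≤ a + b → s p = -(a : ℤ) - u - 1 := by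
    intro p h1 h2
    have h3 := S.W (offset n π A p) (by omega) (by omega)
    rw [hoff p] at h3
    omega
  refine ⟨?_, ?_, ?_, ?_, ?_, ?_⟩
  · intro p q h1 h2 h3
    have := sU p h1
    have := sU q h2
    have := hd p q
    unfold Bigger at h3
    omega
  · intro p q h1 h2 h3 h4 h5
    have := sW p h1 h2
    have := sW q h3 h4
    have := hd p q
    unfold Bigger at h5
    omega
  · intro p hp
    have h1 := S.Z.2
    have h2 := hoff p
    rw [hp] at h2
    push_cast at h2
    omega
  · intro p q h1 h2 h3
    have hq := S.W (offset n π A q) (by omega) (by omega)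
    rcases h1 with h1 | h1
    · have hb := big_iff n π s (π A) (offset n π A p) (offset n π A q) (by omega) (by omega)
      rw [← off_eq n π A p, ← off_eq n π A q] at hb
      rw [hb, hq]
      rcases Nat.eq_zero_or_pos (offset n π A p) with h0 | h0
      · have := S.A
        rw [h0, Nat.cast_zero]; omega
      · have := S.X (offset n π A p) (by omega) (by omega)
        omega
    · have hlt := off_lt n π A p
      have hb := big_iff n π s (π A) ((offset n π A p : ℤ) - n) (offset n π A q) (by omega)
        (by omega)
      have hcast : (((offset n π A p : ℤ) - n : ℤ) : ZMod n) = ((offset n π A p : ℤ) : ZMod n) := by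
        simp
      rw [hcast, ← off_eq n π A p, ← off_eq n π A q] at hb
      have := S.U ((offset n π A p : ℤ) - n) (by omega) (by omega)
      rw [hb, hq]
      omega
  · refine ⟨a, id, rfl, rfl, fun i _ => Nat.lt_succ_self i, fun i _ => Or.inl ?_⟩
    intro p q h1 h2 h3 h4 h5
    simp only [id] at h1 h2 h3 h4
    have : p = q := by
      rw [off_eq n π A p, off_eq n π A q, show offset n π A p = offset n π A q by omega]
    subst this
    have := hd p p
    unfold Bigger at h5
    omega
  · rcases Nat.eq_zero_or_pos a with ha | ha
    · subst ha
      exact route_0 n u b π s A S hsize hs hsum hn he hu hb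
    · exact main_route n (by omega) he π s (π A) hs hsum hmin (a + 1)
        fun v c h1 h2 h3 => two_a n u a b _ S hper hsize he hu hb ha v c h1 h2 h3
end
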